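/- arXiv:2408.14618 — 4 statements merged into one kernel-verified Lean document; each statement's English description precedes it below -/
import Mathlib

section
/- Let Y be a d×M random matrix whose entries are jointly centered real Gaussian random variables. Define the d×d auto-covariance matrices A_{s,s'} = E[Y_{•,s} Y_{•,s'}^T] of its columns, and let B be the symmetric M×M matrix with entries B_{s,s'} = ‖A_{s,s'}‖, where ‖·‖ denotes the operator norm. If ‖B‖ ≤ κ for some κ > 0, then for every L ∈ ℕ one has E[tr((Y Y^T)^L)] ≤ κ^L (2L−1)!! (d+M)^{L+1}. -/
open MeasureTheory ProbabilityTheory Matrix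

/-- The operator norm of a matrix over `ℝ` or `ℂ`, viewed as a linear map between
Euclidean spaces. -/
noncomputable def opNorm {𝕜 : Type*} [RCLike 𝕜] {a b : ℕ} (A : Matrix (Fin a) (Fin b) 𝕜) : ℝ :=
  ‖LinearMap.toContinuousLinearMap (Matrix.toEuclideanLin A)‖

/-- A finite family of real random variables jointly follows a centered (possibly degenerate)
Gaussian distribution iff every linear combination of them is a (possibly degenerate) centered
real Gaussian random variable. -/
def IsCenteredGaussianFamily {Ω : Type*} [MeasurableSpace Ω] (P : Measure Ω)
    {ι : Type*} [Fintype ι] (Y : ι → Ω → ℝ) : Prop :=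
  ∀ c : ι → ℝ, ∃ v : NNReal,
    Measure.map (fun ω => ∑ i, c i * Y i ω) P = gaussianReal 0 v


namespace GramAux

lemma memLp_poly_gaussian (v : NNReal) (g : Polynomial ℝ) :
    Integrable (fun x => g.eval x) (gaussianReal 0 v) := by
  induction g using Polynomial.induction_on' with
  | add p q hp hq => simp only [Polynomial.eval_add]; exact hp.add hq
  | monomial n a =>
    simp only [Polynomial.eval_monomial]
    apply Integrable.const_mul
    have := (memLp_id_gaussianReal (μ := 0) (v := v) n).integrable_norm_pow'
    refine (integrable_norm_iff ?_).1 ?_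
    · fun_prop
    · simpa using this

lemma stein_poly (v : NNReal) (g : Polynomial ℝ) :
    ∫ x, x * g.eval x ∂(gaussianReal 0 v) =
      v * ∫ x, g.derivative.eval x ∂(gaussianReal 0 v) := by
  by_cases hv : v = 0
  · subst hv
    simp [gaussianReal_zero_var]
  have hv' : (v : ℝ) ≠ 0 := by exact_mod_cast hv
  have hIg : ∀ g : Polynomial ℝ, Integrable (fun x => g.eval x * gaussianPDFReal 0 v x) := by
    intro g
    have := memLp_poly_gaussian v g
    rw [gaussianReal_of_var_ne_zero _ hv, integrable_withDensity_iff_integrable_smul'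
      (measurable_gaussianPDF 0 v) (by simp [gaussianPDF_lt_top])] at this
    simpa [mul_comm] using this
  have hd : ∀ x, HasDerivAt (gaussianPDFReal 0 v) (-(x / v) * gaussianPDFReal 0 v x) x := by
    intro x
    rw [gaussianPDFReal_def]
    have h1 : HasDerivAt (fun x : ℝ => -(x - 0) ^ 2 / (2 * (v : ℝ))) (-(x / v)) x := by
      have := (((hasDerivAt_id x).sub_const 0).pow 2).neg.div_const (2 * (v : ℝ))
      convert! this using 1
      field_simp
      simp [mul_comm]
    have := (h1.exp).const_mul (√(2 * Real.pi * v))⁻¹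
    convert! this using 1
    ring
  have key := integral_mul_deriv_eq_deriv_mul_of_integrable (u := fun x => g.eval x)
    (v := gaussianPDFReal 0 v) (u' := fun x => g.derivative.eval x)
    (v' := fun x => -(x / v) * gaussianPDFReal 0 v x)
    (fun x _ => g.hasDerivAt x) (fun x _ => hd x)
    (by
      have := (hIg (Polynomial.X * g)).const_mul (-(v : ℝ)⁻¹)
      refine this.congr (Filter.Eventually.of_forall fun x => ?_)
      simp only [Polynomial.eval_mul, Polynomial.eval_X, Pi.mul_apply]
      field_simp)
    (hIg _) (hIg _)
  rw [integral_gaussianReal_eq_integral_smul hv, integral_gaussianReal_eq_integral_smul hv]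
  have e1 : ∫ x, gaussianPDFReal 0 v x • (x * g.eval x)
      = -v * ∫ x, g.eval x * (-(x / v) * gaussianPDFReal 0 v x) := by
    rw [← integral_const_mul]
    congr 1; ext x
    simp only [smul_eq_mul]
    field_simp
  rw [e1, key]
  simp only [smul_eq_mul, neg_mul_neg]
  congr 2; ext x; ring

variable {Ω : Type*} [MeasurableSpace Ω] {P : Measure Ω} {ι : Type*} [Fintype ι] {Y : ι → Ω → ℝ}

lemma family_single (h : IsCenteredGaussianFamily P Y) (i : ι) :
    ∃ v : NNReal, P.map (Y i) = gaussianReal 0 v := by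
  classical
  obtain ⟨v, hv⟩ := h (Pi.single i 1)
  refine ⟨v, ?_⟩
  rw [← hv]
  congr 1; ext ω
  simp [Pi.single_apply]

lemma family_aemeasurable (h : IsCenteredGaussianFamily P Y) (i : ι) : AEMeasurable (Y i) P := by
  obtain ⟨v, hv⟩ := family_single h i
  exact aemeasurable_of_map_neZero (by rw [hv]; infer_instance)

lemma family_hasGaussianLaw (h : IsCenteredGaussianFamily P Y) :
    HasGaussianLaw (fun ω i => Y i ω) P := by
  classical
  constructor
  have hm : AEMeasurable (fun ω i => Y i ω) P := aemeasurable_pi_lambda _ (family_aemeasurable h)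
  apply isGaussian_of_map_eq_gaussianReal
  intro L
  obtain ⟨v, hv⟩ := h (fun i => L (Pi.single i 1))
  refine ⟨0, v, ?_⟩
  rw [AEMeasurable.map_map_of_aemeasurable (by fun_prop) hm, ← hv]
  congr 1; ext ω
  have : (fun i => Y i ω) = ∑ i, Y i ω • (Pi.single i (1:ℝ) : ι → ℝ) := by
    ext j; simp [Finset.sum_apply, Pi.single_apply]
  simp only [Function.comp]
  rw [this]
  simp [mul_comm]

lemma memLp_mvpoly (h : IsCenteredGaussianFamily P Y) [IsProbabilityMeasure P]
    (f : MvPolynomial ι ℝ) : ∀ n : ℕ,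
    MemLp (fun ω => MvPolynomial.eval (fun q => Y q ω) f) (2 ^ n : ENNReal) P := by
  induction f using MvPolynomial.induction_on with
  | C a => intro n; simpa using memLp_const a
  | add p q hp hq => intro n; simp only [map_add]; exact (hp n).add (hq n)
  | mul_X p i hp =>
    intro n
    have h1 := hp (n+1)
    have h2 : MemLp (Y i) (2 ^ (n+1) : ENNReal) P :=
      ((family_hasGaussianLaw h).eval i).memLp (by simp)
    have : ENNReal.HolderTriple (2 ^ (n+1)) (2 ^ (n+1)) (2 ^ n) := by
      constructor
      rw [pow_succ, ENNReal.mul_inv (by simp) (by simp), ← mul_add, ENNReal.inv_two_add_inv_two,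
        mul_one]
    simpa using MemLp.mul' (r := 2 ^ n) h2 h1

lemma integrable_mvpoly (h : IsCenteredGaussianFamily P Y) [IsProbabilityMeasure P]
    (f : MvPolynomial ι ℝ) :
    Integrable (fun ω => MvPolynomial.eval (fun q => Y q ω) f) P := by
  have := memLp_mvpoly h f 0
  rw [pow_zero] at this
  exact memLp_one_iff_integrable.1 this

lemma derivative_line [DecidableEq ι] (a z : ι → ℝ) (f : MvPolynomial ι ℝ) :
    Polynomial.derivative
      (MvPolynomial.aeval (fun q => Polynomial.C (a q) * Polynomial.X + Polynomial.C (z q)) f) =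
    ∑ q, Polynomial.C (a q) *
      MvPolynomial.aeval (fun q => Polynomial.C (a q) * Polynomial.X + Polynomial.C (z q))
        (MvPolynomial.pderiv q f) := by
  induction f using MvPolynomial.induction_on with
  | C a => simp
  | add p q hp hq => simp [hp, hq, mul_add, Finset.sum_add_distrib]
  | mul_X p i hp =>
    simp only [map_mul, MvPolynomial.aeval_X, Polynomial.derivative_mul, hp,
      Derivation.leibniz, MvPolynomial.pderiv_X, map_add, smul_eq_mul, mul_add,
      Finset.sum_add_distrib]
    simp only [Polynomial.derivative_C, Polynomial.derivative_X, zero_mul, mul_one]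
    simp only [Pi.single_apply, apply_ite (MvPolynomial.aeval (R := ℝ) (fun q => Polynomial.C (a q) * Polynomial.X + Polynomial.C (z q))), map_one, map_zero, mul_ite, mul_one, mul_zero,
      Finset.sum_ite_eq, Finset.sum_ite_eq', Finset.mem_univ, if_true]
    have e : ∀ (c : Polynomial ℝ) (A : ι → Polynomial ℝ),
        ∑ x, Polynomial.C (a x) * (c * A x) = c * ∑ x, Polynomial.C (a x) * A x := by
      intro c A
      rw [Finset.mul_sum]
      apply Finset.sum_congr rfl
      intro q _; ring
    rw [e]
    ring

lemma eval_line (a z : ι → ℝ) (f : MvPolynomial ι ℝ) (x : ℝ) :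
    Polynomial.eval x
      (MvPolynomial.aeval (fun q => Polynomial.C (a q) * Polynomial.X + Polynomial.C (z q)) f) =
    MvPolynomial.eval (fun q => a q * x + z q) f := by
  induction f using MvPolynomial.induction_on with
  | C a => simp
  | add p q hp hq => simp [hp, hq]
  | mul_X p i hp => simp [hp]

lemma measurable_eval_mv (f : MvPolynomial ι ℝ) :
    Measurable (fun y : ι → ℝ => MvPolynomial.eval y f) := by
  induction f using MvPolynomial.induction_on with
  | C a => simp
  | add p q hp hq => simp only [map_add]; exact hp.add hq
  | mul_X p i hp => simp only [map_mul, MvPolynomial.eval_X]; exact hp.mul (measurable_pi_apply i)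

lemma gaussian_ibp [DecidableEq ι] [IsProbabilityMeasure P] (h : IsCenteredGaussianFamily P Y)
    (p : ι) (f : MvPolynomial ι ℝ) :
    ∫ ω, Y p ω * MvPolynomial.eval (fun q => Y q ω) f ∂P =
      ∑ q, (∫ ω, Y p ω * Y q ω ∂P) *
        ∫ ω, MvPolynomial.eval (fun q => Y q ω) (MvPolynomial.pderiv q f) ∂P := by
  obtain ⟨v, hv⟩ := family_single h p
  have hG := family_hasGaussianLaw h
  have hL2 : ∀ q, MemLp (Y q) 2 P := fun q => (hG.eval q).memLp (by simp)
  have hmean : ∀ q, ∫ ω, Y q ω ∂P = 0 := by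
    intro q
    obtain ⟨w, hw⟩ := family_single h q
    have := integral_map (family_aemeasurable h q) (f := fun x : ℝ => x) (by fun_prop)
    rw [← this, hw, integral_id_gaussianReal]
  have hvar : ∫ ω, Y p ω * Y p ω ∂P = v := by
    have h1 : Var[Y p; P] = v := by
      rw [← variance_id_map (family_aemeasurable h p), hv, variance_id_gaussianReal]
    rw [variance_eq_integral (family_aemeasurable h p)] at h1
    simpa [hmean, pow_two] using h1
  obtain ⟨a, ha⟩ : ∃ a : ι → ℝ, ∀ q, ∫ ω, Y p ω * Y q ω ∂P = v * a q := by
    by_cases hv0 : v = 0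
    · refine ⟨0, fun q => ?_⟩
      have : ∀ᵐ x ∂(P.map (Y p)), x = 0 := by
        rw [hv, hv0, gaussianReal_zero_var, ae_dirac_iff (by simp)]
      have := ae_of_ae_map (family_aemeasurable h p) this
      rw [integral_eq_zero_of_ae]
      · simp
      · filter_upwards [this] with ω hω
        simp [hω]
    · refine ⟨fun q => (∫ ω, Y p ω * Y q ω ∂P) / v, fun q => ?_⟩
      have : (v : ℝ) ≠ 0 := by exact_mod_cast hv0
      field_simp
  let Z : ι → Ω → ℝ := fun q ω => Y q ω - a q * Y p ω
  have hZm : AEMeasurable (fun ω q => Z q ω) P := aemeasurable_pi_lambda _ fun q =>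
    (family_aemeasurable h q).sub ((family_aemeasurable h p).const_mul _)
  have hXm := family_aemeasurable h p
  have hind : IndepFun (Y p) (fun ω q => Z q ω) P := by
    have hjoint : HasGaussianLaw
        (fun ω => ((fun _ : Unit => Y p ω), (fun q => Z q ω))) P := by
      let T : (ι → ℝ) →L[ℝ] (Unit → ℝ) × (ι → ℝ) :=
        (ContinuousLinearMap.pi fun _ => ContinuousLinearMap.proj p).prod
          (ContinuousLinearMap.pi fun q =>
            ContinuousLinearMap.proj q - a q • ContinuousLinearMap.proj p)
      exact hG.map_fun T
    have := hjoint.indepFun_of_covariance_eval (X := fun _ : Unit => Y p) (Y := Z) (by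
      intro _ q
      have hZ2 : MemLp (Z q) 2 P := (hL2 q).sub ((hL2 p).const_mul _)
      rw [covariance_eq_sub (hL2 p) hZ2]
      simp only [hmean, zero_mul, sub_zero]
      have : (Y p * Z q) = fun ω => Y p ω * Y q ω - a q * (Y p ω * Y p ω) := by
        ext ω; simp [Z]; ring
      have i1 : Integrable (fun ω => Y p ω * Y q ω) P := (hL2 p).integrable_mul (hL2 q)
      have i2 : Integrable (fun ω => a q * (Y p ω * Y p ω)) P :=
        ((hL2 p).integrable_mul (hL2 p)).const_mul _
      rw [this, integral_sub i1 i2, integral_const_mul, hvar, ha]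
      ring)
    exact this.comp (φ := fun x : Unit → ℝ => x ()) (ψ := id) (by fun_prop) measurable_id
  have hprod := (indepFun_iff_map_prod_eq_prod_map_map hXm hZm).1 hind
  have hpairm : AEMeasurable (fun ω => (Y p ω, fun q => Z q ω)) P := hXm.prodMk hZm
  have hYrec : ∀ ω, (fun q => Y q ω) = fun q => a q * Y p ω + Z q ω := by
    intro ω; ext q; simp [Z]
  have : IsProbabilityMeasure (P.map (fun ω q => Z q ω)) := Measure.isProbabilityMeasure_map hZm
  -- transfer
  have transfer : ∀ g : ℝ → (ι → ℝ) → ℝ, Measurable (Function.uncurry g) →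
      Integrable (fun ω => g (Y p ω) (fun q => Z q ω)) P →
      ∫ ω, g (Y p ω) (fun q => Z q ω) ∂P =
        ∫ z, ∫ x, g x z ∂(gaussianReal 0 v) ∂(P.map (fun ω q => Z q ω)) := by
    intro g hg hgi
    have e1 := integral_map hpairm (f := Function.uncurry g) hg.aestronglyMeasurable
    have e2 : Integrable (Function.uncurry g) (P.map (fun ω => (Y p ω, fun q => Z q ω))) := by
      rw [integrable_map_measure hg.aestronglyMeasurable hpairm]
      exact hgi
    rw [hprod, hv] at e1 e2
    rw [integral_prod_symm _ e2] at e1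
    exact e1.symm
  have hmeas : ∀ f : MvPolynomial ι ℝ, Measurable
      (fun t : ℝ × (ι → ℝ) => MvPolynomial.eval (fun q => a q * t.1 + t.2 q) f) := by
    intro f
    exact (measurable_eval_mv f).comp (by fun_prop)
  have hL := transfer (fun x z => x * MvPolynomial.eval (fun q => a q * x + z q) f)
    (measurable_fst.mul (hmeas f)) (by
      have := integrable_mvpoly h (MvPolynomial.X p * f)
      simp only [← hYrec]
      simpa using this)
  have hIq : ∀ q, Integrable
      (fun ω => a q * MvPolynomial.eval (fun q => Y q ω) (MvPolynomial.pderiv q f)) P :=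
    fun q => (integrable_mvpoly h (MvPolynomial.pderiv q f)).const_mul _
  have hR := transfer (fun x z => ∑ q, a q *
      MvPolynomial.eval (fun q => a q * x + z q) (MvPolynomial.pderiv q f))
    (by
      refine Finset.measurable_sum _ fun q _ => ?_
      exact (hmeas (MvPolynomial.pderiv q f)).const_mul (a q)) (by
      simp only [← hYrec]
      exact integrable_finsetSum _ fun q _ => hIq q)
  simp only [← hYrec] at hL hR
  rw [hL]
  have hin : ∀ z : ι → ℝ, ∫ x, x * MvPolynomial.eval (fun q => a q * x + z q) f ∂(gaussianReal 0 v)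
      = v * ∫ x, ∑ q, a q *
      MvPolynomial.eval (fun q => a q * x + z q) (MvPolynomial.pderiv q f) ∂(gaussianReal 0 v) := by
    intro z
    have := stein_poly v
      (MvPolynomial.aeval (fun q => Polynomial.C (a q) * Polynomial.X + Polynomial.C (z q)) f)
    rw [derivative_line] at this
    simpa only [eval_line, Polynomial.eval_finsetSum, Polynomial.eval_mul, Polynomial.eval_C]
      using this
  simp only [hin]
  rw [integral_const_mul, ← hR, integral_finsetSum _ (fun q _ => hIq q), Finset.mul_sum]
  apply Finset.sum_congr rfl
  intro q _
  rw [ha, integral_const_mul, mul_assoc]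

end GramAux

namespace GramAux

lemma spectral_pow {n : ℕ} (W : Matrix (Fin n) (Fin n) ℝ) (hW : W.PosSemidef) :
    ∃ (l : Fin n → ℝ) (U : Matrix (Fin n) (Fin n) ℝ), (∀ i, 0 ≤ l i) ∧ Uᵀ * U = 1 ∧
      ∀ k : ℕ, W ^ k = U * diagonal (fun i => l i ^ k) * Uᵀ := by
  have hs := hW.1.spectral_theorem
  have hU : (hW.1.eigenvectorUnitary : Matrix (Fin n) (Fin n) ℝ)ᵀ * hW.1.eigenvectorUnitary = 1 := by
    have := Unitary.coe_star_mul_self hW.1.eigenvectorUnitary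
    simpa [star_eq_conjTranspose] using this
  have hU2 := mul_eq_one_comm.1 hU
  refine ⟨hW.1.eigenvalues, hW.1.eigenvectorUnitary, hW.eigenvalues_nonneg, hU, ?_⟩
  set U := (hW.1.eigenvectorUnitary : Matrix (Fin n) (Fin n) ℝ)
  have hW1 : W = U * diagonal hW.1.eigenvalues * Uᵀ := by
    rw [Unitary.conjStarAlgAut_apply] at hs
    simpa [star_eq_conjTranspose, Function.comp_def] using! hs
  intro k
  induction k with
  | zero => simp [hU2]
  | succ k ih =>
    rw [pow_succ, ih]
    refine (congrArg (fun Z => U * diagonal (fun i => hW.1.eigenvalues i ^ k) * Uᵀ * Z) hW1).trans ?_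
    calc U * diagonal (fun i => hW.1.eigenvalues i ^ k) * Uᵀ * (U * diagonal hW.1.eigenvalues * Uᵀ)
        = U * diagonal (fun i => hW.1.eigenvalues i ^ k) * (Uᵀ * U) * diagonal hW.1.eigenvalues * Uᵀ := by
          simp only [Matrix.mul_assoc]
      _ = _ := by
          rw [hU, Matrix.mul_one, Matrix.mul_assoc U, diagonal_mul_diagonal]
          simp only [pow_succ]

lemma factor_pow {n : ℕ} (W : Matrix (Fin n) (Fin n) ℝ) (hW : W.PosSemidef) (k : ℕ) :
    ∃ C : Matrix (Fin n) (Fin n) ℝ, W ^ k = C * Cᵀ := by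
  obtain ⟨l, U, hl, -, h⟩ := spectral_pow W hW
  refine ⟨U * diagonal (fun i => √(l i ^ k)), ?_⟩
  rw [h, transpose_mul, diagonal_transpose, Matrix.mul_assoc, Matrix.mul_assoc,
    ← Matrix.mul_assoc (diagonal _) (diagonal _), diagonal_mul_diagonal]
  congr 3
  ext i
  rw [Real.mul_self_sqrt (pow_nonneg (hl i) k)]

lemma trace_pow_spec {n : ℕ} (W : Matrix (Fin n) (Fin n) ℝ) (hW : W.PosSemidef) :
    ∃ l : Fin n → ℝ, (∀ i, 0 ≤ l i) ∧ ∀ k, trace (W ^ k) = ∑ i, l i ^ k := by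
  obtain ⟨l, U, hl, hU, h⟩ := spectral_pow W hW
  refine ⟨l, hl, fun k => ?_⟩
  rw [h, Matrix.mul_assoc, trace_mul_comm, Matrix.mul_assoc, hU, Matrix.mul_one, trace_diagonal]

lemma trace_pow_nonneg {n : ℕ} (W : Matrix (Fin n) (Fin n) ℝ) (hW : W.PosSemidef) (k : ℕ) :
    0 ≤ trace (W ^ k) := by
  obtain ⟨l, hl, h⟩ := trace_pow_spec W hW
  rw [h]
  exact Finset.sum_nonneg fun i _ => pow_nonneg (hl i) k

lemma trace_pow_mul_le {n : ℕ} (W : Matrix (Fin n) (Fin n) ℝ) (hW : W.PosSemidef) (a b : ℕ) :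
    trace (W ^ a) * trace (W ^ b) ≤ n * trace (W ^ (a + b)) := by
  obtain ⟨l, hl, h⟩ := trace_pow_spec W hW
  simp only [h]
  have hm : MonovaryOn (fun i => l i ^ a) (fun i => l i ^ b) (Finset.univ : Finset (Fin n)) := by
    intro i _ j _ hij
    have : l i ≤ l j := by
      by_contra hc
      exact absurd hij (not_lt.2 (pow_le_pow_left₀ (hl j) (not_le.1 hc).le b))
    exact pow_le_pow_left₀ (hl i) this a
  have := hm.sum_mul_sum_le_card_mul_sum
  simpa [pow_add] using this

lemma trace_pow_two_mul_le {n : ℕ} (W : Matrix (Fin n) (Fin n) ℝ) (hW : W.PosSemidef) (a : ℕ) :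
    trace (W ^ (2 * a)) ≤ trace (W ^ a) ^ 2 := by
  obtain ⟨l, hl, h⟩ := trace_pow_spec W hW
  simp only [h]
  have := Finset.sum_sq_le_sq_sum_of_nonneg (s := (Finset.univ : Finset (Fin n)))
    (f := fun i => l i ^ a) (fun i _ => pow_nonneg (hl i) a)
  simpa [← pow_mul, mul_comm] using this

lemma bilin_le {a b : ℕ} (A : Matrix (Fin a) (Fin b) ℝ) (u : Fin a → ℝ) (v : Fin b → ℝ) :
    ∑ i, ∑ j, A i j * u i * v j ≤ opNorm A * (√(∑ i, u i ^ 2) * √(∑ j, v j ^ 2)) := by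
  have h1 := real_inner_le_norm (WithLp.toLp 2 u)
    (LinearMap.toContinuousLinearMap (Matrix.toEuclideanLin A) (WithLp.toLp 2 v))
  have h2 := (LinearMap.toContinuousLinearMap (Matrix.toEuclideanLin A)).le_opNorm (WithLp.toLp 2 v)
  have nu : ‖WithLp.toLp 2 u‖ = √(∑ i, u i ^ 2) := by simp [EuclideanSpace.norm_eq]
  have nv : ‖WithLp.toLp 2 v‖ = √(∑ i, v i ^ 2) := by simp [EuclideanSpace.norm_eq]
  have e : inner ℝ (WithLp.toLp 2 u)
    (LinearMap.toContinuousLinearMap (Matrix.toEuclideanLin A) (WithLp.toLp 2 v)) =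
      ∑ i, ∑ j, A i j * u i * v j := by
    simp [PiLp.inner_apply, Matrix.toLpLin_apply, Matrix.mulVec, dotProduct, Finset.mul_sum, Finset.sum_mul]
    refine Finset.sum_congr rfl fun i _ => Finset.sum_congr rfl fun j _ => by ring
  rw [e] at h1
  rw [nv] at h2
  rw [nu] at h1
  unfold opNorm
  refine h1.trans ((mul_le_mul_of_nonneg_left h2 (Real.sqrt_nonneg _)).trans (le_of_eq (by ring)))

section block
variable {d M : ℕ} {A : Fin M → Fin M → Matrix (Fin d) (Fin d) ℝ} {B : Matrix (Fin M) (Fin M) ℝ}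
  {κ : ℝ}

lemma block_le (hBκ : opNorm B ≤ κ) (u v : Fin M → Fin d → ℝ) (I : Fin M → Fin M → ℝ)
    (hI : ∀ s s', I s s' ≤ B s s' * (√(∑ j, u s j ^ 2) * √(∑ j, v s' j ^ 2))) :
    ∑ s, ∑ s', I s s' ≤ κ * (√(∑ s, ∑ j, u s j ^ 2) * √(∑ s, ∑ j, v s j ^ 2)) := by
  have h := bilin_le B (fun s => √(∑ j, u s j ^ 2)) (fun s => √(∑ j, v s j ^ 2))
  have e : ∀ w : Fin M → Fin d → ℝ, ∑ s, √(∑ j, w s j ^ 2) ^ 2 = ∑ s, ∑ j, w s j ^ 2 := by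
    intro w
    refine Finset.sum_congr rfl fun s _ => Real.sq_sqrt (Finset.sum_nonneg fun j _ => sq_nonneg _)
  rw [e, e] at h
  calc ∑ s, ∑ s', I s s' ≤ ∑ s, ∑ s', B s s' * √(∑ j, u s j ^ 2) * √(∑ j, v s' j ^ 2) := by
        refine Finset.sum_le_sum fun s _ => Finset.sum_le_sum fun s' _ => ?_
        rw [mul_assoc]; exact hI s s'
    _ ≤ _ := h
    _ ≤ _ := mul_le_mul_of_nonneg_right hBκ (by positivity)

lemma block_straight (hB : ∀ s s', B s s' = opNorm (A s s')) (hBκ : opNorm B ≤ κ)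
    (u v : Fin M → Fin d → ℝ) :
    ∑ s, ∑ s', ∑ j, ∑ j', A s s' j j' * (u s j * v s' j') ≤
      κ * (√(∑ s, ∑ j, u s j ^ 2) * √(∑ s, ∑ j, v s j ^ 2)) := by
  refine block_le hBκ u v _ fun s s' => ?_
  rw [hB]
  simpa only [mul_assoc] using bilin_le (A s s') (u s) (v s')

lemma block_twist (hB : ∀ s s', B s s' = opNorm (A s s')) (hBκ : opNorm B ≤ κ)
    (u v : Fin M → Fin d → ℝ) :
    ∑ s, ∑ s', ∑ j, ∑ j', A s s' j j' * (u s j' * v s' j) ≤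
      κ * (√(∑ s, ∑ j, u s j ^ 2) * √(∑ s, ∑ j, v s j ^ 2)) := by
  refine block_le hBκ u v _ fun s s' => ?_
  rw [hB, mul_comm (√(∑ j, u s j ^ 2))]
  have := bilin_le (A s s') (v s') (u s)
  refine le_trans (le_of_eq ?_) this
  refine Finset.sum_congr rfl fun i _ => Finset.sum_congr rfl fun j _ => by ring

lemma block_factor (hB : ∀ s s', B s s' = opNorm (A s s')) (hBκ : opNorm B ≤ κ)
    (C : Matrix (Fin M) (Fin M) ℝ) (D : Matrix (Fin d) (Fin d) ℝ) :
    ∑ s, ∑ s', ∑ j, ∑ j', A s s' j j' * ((C * Cᵀ) s s' * (D * Dᵀ) j' j) ≤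
      κ * (trace (C * Cᵀ) * trace (D * Dᵀ)) := by
  have h : ∀ a b, ∑ s, ∑ s', ∑ j, ∑ j', A s s' j j' * ((C s a * D j b) * (C s' a * D j' b)) ≤
      κ * ∑ s, ∑ j, (C s a * D j b) ^ 2 := by
    intro a b
    have := block_straight hB hBκ (fun s j => C s a * D j b) (fun s j => C s a * D j b)
    rwa [Real.mul_self_sqrt (by positivity)] at this
  have h2 := Finset.sum_le_sum fun a (_ : a ∈ Finset.univ) =>
    Finset.sum_le_sum fun b (_ : b ∈ Finset.univ) => h a b
  refine le_trans (le_of_eq ?_) (h2.trans (le_of_eq ?_))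
  · simp only [Matrix.mul_apply, transpose_apply]
    symm
    calc _ = ∑ a, ∑ s, ∑ s', ∑ j, ∑ j', ∑ b, A s s' j j' * ((C s a * D j b) * (C s' a * D j' b)) := by
            refine Finset.sum_congr rfl fun a _ => ?_
            rw [Finset.sum_comm]; refine Finset.sum_congr rfl fun s _ => ?_
            rw [Finset.sum_comm]; refine Finset.sum_congr rfl fun s' _ => ?_
            rw [Finset.sum_comm]; refine Finset.sum_congr rfl fun j _ => ?_
            rw [Finset.sum_comm]
      _ = _ := by
            rw [Finset.sum_comm]; refine Finset.sum_congr rfl fun s _ => ?_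
            rw [Finset.sum_comm]; refine Finset.sum_congr rfl fun s' _ => ?_
            rw [Finset.sum_comm]; refine Finset.sum_congr rfl fun j _ => ?_
            rw [Finset.sum_comm]; refine Finset.sum_congr rfl fun j' _ => ?_
            rw [Finset.sum_mul_sum, Finset.mul_sum]
            refine Finset.sum_congr rfl fun a _ => ?_
            rw [Finset.mul_sum]
            refine Finset.sum_congr rfl fun b _ => by ring
  · simp only [trace, diag_apply, Matrix.mul_apply, transpose_apply, ← Finset.mul_sum]
    congr 1
    calc ∑ a, ∑ b, ∑ s, ∑ j, (C s a * D j b) ^ 2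
        = ∑ a, ∑ b, (∑ s, C s a ^ 2) * (∑ j, D j b ^ 2) := by
          simp only [mul_pow, Finset.sum_mul_sum]
      _ = (∑ a, ∑ s, C s a ^ 2) * (∑ b, ∑ j, D j b ^ 2) := by
          rw [Finset.sum_mul_sum]
      _ = _ := by
          rw [Finset.sum_comm, Finset.sum_comm (f := fun b j => D j b ^ 2)]
          simp only [pow_two]

lemma gram_posSemidef {a b : ℕ} (Y : Matrix (Fin a) (Fin b) ℝ) : (Y * Yᵀ).PosSemidef := by
  have := Matrix.posSemidef_self_mul_conjTranspose Y
  simpa using this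

lemma gram_posSemidef' {a b : ℕ} (Y : Matrix (Fin a) (Fin b) ℝ) : (Yᵀ * Y).PosSemidef := by
  have := Matrix.posSemidef_conjTranspose_mul_self Y
  simpa using this

lemma gram_shift {R : Type*} [CommRing R] {a b : ℕ} (Y : Matrix (Fin a) (Fin b) R) (k : ℕ) :
    Yᵀ * (Y * Yᵀ) ^ k * Y = (Yᵀ * Y) ^ (k + 1) := by
  induction k with
  | zero => simp
  | succ k ih =>
    rw [pow_succ (Yᵀ * Y), ← ih, pow_succ]
    simp only [Matrix.mul_assoc]

lemma trace_gram_pow_succ {a b : ℕ} (Y : Matrix (Fin a) (Fin b) ℝ) (k : ℕ) :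
    trace ((Yᵀ * Y) ^ (k + 1)) = trace ((Y * Yᵀ) ^ (k + 1)) := by
  rw [← gram_shift, trace_mul_comm, ← Matrix.mul_assoc, pow_succ']

lemma term1 (hB : ∀ s s', B s s' = opNorm (A s s')) (hκ : 0 < κ) (hBκ : opNorm B ≤ κ)
    (Y : Matrix (Fin d) (Fin M) ℝ) (k l : ℕ) :
    ∑ s, ∑ s', ∑ j, ∑ j', A s s' j j' * (((Yᵀ * Y) ^ k) s s' * ((Y * Yᵀ) ^ l) j' j) ≤
      κ * (((d : ℝ) + M) * trace ((Y * Yᵀ) ^ (k + l))) := by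
  obtain ⟨C, hC⟩ := factor_pow _ (gram_posSemidef' Y) k
  obtain ⟨D, hD⟩ := factor_pow _ (gram_posSemidef Y) l
  have h := block_factor hB hBκ C D
  rw [← hC, ← hD] at h
  refine h.trans (mul_le_mul_of_nonneg_left ?_ hκ.le)
  have hn := trace_pow_nonneg _ (gram_posSemidef Y) (k + l)
  cases k with
  | zero =>
    simp only [pow_zero, trace_one, Fintype.card_fin, zero_add] at hn ⊢
    nlinarith [mul_nonneg (Nat.cast_nonneg (α := ℝ) d) hn]
  | succ k =>
    rw [trace_gram_pow_succ]
    have := trace_pow_mul_le _ (gram_posSemidef Y) (k + 1) l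
    nlinarith [mul_nonneg (Nat.cast_nonneg (α := ℝ) M) hn]

lemma frob_T (Y : Matrix (Fin d) (Fin M) ℝ) (k : ℕ) :
    ∑ s, ∑ j, (Yᵀ * (Y * Yᵀ) ^ k) s j ^ 2 = trace ((Y * Yᵀ) ^ (2 * k + 1)) := by
  have ht : ((Y * Yᵀ) ^ k)ᵀ = (Y * Yᵀ) ^ k := by
    rw [transpose_pow]; simp
  have e : trace ((Y * Yᵀ) ^ (2 * k + 1)) =
      trace ((Yᵀ * (Y * Yᵀ) ^ k) * (Yᵀ * (Y * Yᵀ) ^ k)ᵀ) := by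
    rw [trace_mul_comm, transpose_mul, ht, transpose_transpose]
    congr 1
    rw [show 2 * k + 1 = k + 1 + k by ring, pow_add, pow_succ]
    simp only [Matrix.mul_assoc]
  rw [e]
  simp only [trace, diag_apply, Matrix.mul_apply (M := Yᵀ * (Y * Yᵀ) ^ k), transpose_apply, pow_two]

lemma term2 (hB : ∀ s s', B s s' = opNorm (A s s')) (hκ : 0 < κ) (hBκ : opNorm B ≤ κ)
    (Y : Matrix (Fin d) (Fin M) ℝ) (k l : ℕ) :
    ∑ s, ∑ s', ∑ j, ∑ j', A s s' j j' *
        ((Yᵀ * (Y * Yᵀ) ^ k) s j' * (Yᵀ * (Y * Yᵀ) ^ l) s' j) ≤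
      κ * (((d : ℝ) + M) * trace ((Y * Yᵀ) ^ (k + l + 1))) := by
  have h := block_twist hB hBκ (fun s j => (Yᵀ * (Y * Yᵀ) ^ k) s j)
    (fun s j => (Yᵀ * (Y * Yᵀ) ^ l) s j)
  rw [frob_T, frob_T] at h
  refine h.trans (mul_le_mul_of_nonneg_left ?_ hκ.le)
  have hW := gram_posSemidef Y
  have hn := trace_pow_nonneg _ hW (k + l + 1)
  have h1 := trace_pow_mul_le _ hW (2 * k + 1) (2 * l + 1)
  have h2 := trace_pow_two_mul_le _ hW (k + l + 1)
  rw [show 2 * k + 1 + (2 * l + 1) = 2 * (k + l + 1) by ring] at h1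
  rw [← Real.sqrt_mul (trace_pow_nonneg _ hW _)]
  apply Real.sqrt_le_iff.2
  refine ⟨by positivity, ?_⟩
  have hd : (d : ℝ) ≤ ((d : ℝ) + M) ^ 2 := by
    have : d ≤ (d + M) ^ 2 := (Nat.le_add_right d M).trans (Nat.le_self_pow two_ne_zero _)
    exact_mod_cast this
  calc _ ≤ _ := h1
    _ ≤ (d : ℝ) * trace ((Y * Yᵀ) ^ (k + l + 1)) ^ 2 := by gcongr
    _ ≤ ((d : ℝ) + M) ^ 2 * trace ((Y * Yᵀ) ^ (k + l + 1)) ^ 2 := by gcongr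
    _ = _ := by ring

end block
end GramAux

namespace GramAux

section deriv
variable {S : Type*} [CommRing S] [Algebra ℝ S] (D : Derivation ℝ S S)

lemma map_deriv_mul {a b c : ℕ} (N : Matrix (Fin a) (Fin b) S) (N' : Matrix (Fin b) (Fin c) S) :
    (N * N').map D = N.map D * N' + N * N'.map D := by
  ext i j
  simp only [Matrix.map_apply, Matrix.mul_apply, Matrix.add_apply, map_sum, Derivation.leibniz,
    smul_eq_mul, Finset.sum_add_distrib]
  rw [add_comm]
  congr 1
  exact Finset.sum_congr rfl fun k _ => mul_comm _ _

lemma deriv_T {d M : ℕ} (X : Matrix (Fin d) (Fin M) S) (n : ℕ) :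
    (Xᵀ * (X * Xᵀ) ^ n).map D =
      ∑ k ∈ Finset.range (n + 1), (Xᵀ * X) ^ k * (X.map D)ᵀ * (X * Xᵀ) ^ (n - k) +
      ∑ k ∈ Finset.range n, (Xᵀ * (X * Xᵀ) ^ k) * X.map D * (Xᵀ * (X * Xᵀ) ^ (n - 1 - k)) := by
  induction n with
  | zero => simp [Matrix.transpose_map]
  | succ n ih =>
    rw [pow_succ, ← Matrix.mul_assoc, map_deriv_mul, ih, map_deriv_mul, Matrix.add_mul,
      Matrix.mul_add, Finset.sum_range_succ _ (n + 1), Matrix.sum_mul, Matrix.sum_mul]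
    have e1 : ∑ k ∈ Finset.range (n + 1), (Xᵀ * X) ^ k * (X.map D)ᵀ * (X * Xᵀ) ^ (n - k) * (X * Xᵀ)
        = ∑ k ∈ Finset.range (n + 1), (Xᵀ * X) ^ k * (X.map D)ᵀ * (X * Xᵀ) ^ (n + 1 - k) := by
      refine Finset.sum_congr rfl fun k hk => ?_
      have : n + 1 - k = n - k + 1 := by have := Finset.mem_range.1 hk; omega
      rw [this, pow_succ]
      simp only [Matrix.mul_assoc]
    have e2 : ∑ k ∈ Finset.range n, (Xᵀ * (X * Xᵀ) ^ k) * X.map D *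
          (Xᵀ * (X * Xᵀ) ^ (n - 1 - k)) * (X * Xᵀ)
        = ∑ k ∈ Finset.range n, (Xᵀ * (X * Xᵀ) ^ k) * X.map D *
          (Xᵀ * (X * Xᵀ) ^ (n + 1 - 1 - k)) := by
      refine Finset.sum_congr rfl fun k hk => ?_
      have : n + 1 - 1 - k = n - 1 - k + 1 := by have := Finset.mem_range.1 hk; omega
      rw [this, pow_succ]
      simp only [Matrix.mul_assoc]
    have e3 : Xᵀ * (X * Xᵀ) ^ n * (X * Xᵀ.map D) = (Xᵀ * X) ^ (n + 1) * (X.map D)ᵀ *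
        (X * Xᵀ) ^ (n + 1 - (n + 1)) := by
      rw [← gram_shift]
      simp [Matrix.mul_assoc, Matrix.transpose_map]
    have e4 : Xᵀ * (X * Xᵀ) ^ n * (X.map D * Xᵀ) = (Xᵀ * (X * Xᵀ) ^ n) * X.map D *
        (Xᵀ * (X * Xᵀ) ^ (n + 1 - 1 - n)) := by
      simp [Matrix.mul_assoc]
    rw [e1, e2, e3, e4, Finset.sum_range_succ (fun k => Xᵀ * (X * Xᵀ) ^ k * X.map D *
      (Xᵀ * (X * Xᵀ) ^ (n + 1 - 1 - k))) n]
    abel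

end deriv

lemma mul_single_mul_apply {S : Type*} [CommRing S] {a b c e : ℕ} (N : Matrix (Fin a) (Fin b) S)
    (N' : Matrix (Fin c) (Fin e) S) (p : Fin b) (q : Fin c) (i : Fin a) (j : Fin e) :
    (N * Matrix.single p q (1 : S) * N') i j = N i p * N' q j := by
  simp [Matrix.mul_apply, Matrix.single_apply, Finset.sum_mul, ite_and]

section gen
variable {d M : ℕ}

/-- The generic matrix. -/
noncomputable def gX (d M : ℕ) : Matrix (Fin d) (Fin M) (MvPolynomial (Fin d × Fin M) ℝ) :=
  Matrix.of fun j s => MvPolynomial.X (j, s)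

lemma gX_deriv (j' : Fin d) (s' : Fin M) :
    (gX d M).map (MvPolynomial.pderiv (R := ℝ) (j', s')) = Matrix.single j' s' 1 := by
  ext1 j s
  simp [gX, MvPolynomial.pderiv_X, Matrix.single_apply, Pi.single_apply, eq_comm]

variable (y : Matrix (Fin d) (Fin M) ℝ)

/-- Evaluation at a real matrix. -/
noncomputable def ev : MvPolynomial (Fin d × Fin M) ℝ →+* ℝ :=
  MvPolynomial.eval (fun p : Fin d × Fin M => y p.1 p.2)

lemma gX_ev : (gX d M).map (ev y) = y := by
  ext j s
  simp [gX, ev]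

lemma ev_W (n : ℕ) : ((gX d M * (gX d M)ᵀ) ^ n).map (ev y) = (y * yᵀ) ^ n := by
  rw [← RingHom.mapMatrix_apply, map_pow, RingHom.mapMatrix_apply, Matrix.map_mul,
    Matrix.transpose_map, gX_ev]

lemma ev_G (n : ℕ) : (((gX d M)ᵀ * gX d M) ^ n).map (ev y) = (yᵀ * y) ^ n := by
  rw [← RingHom.mapMatrix_apply, map_pow, RingHom.mapMatrix_apply, Matrix.map_mul,
    Matrix.transpose_map, gX_ev]

lemma ev_T (n : ℕ) : ((gX d M)ᵀ * (gX d M * (gX d M)ᵀ) ^ n).map (ev y) = yᵀ * (y * yᵀ) ^ n := by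
  rw [Matrix.map_mul, ev_W, Matrix.transpose_map, gX_ev]

lemma ev_deriv_T (n : ℕ) (j j' : Fin d) (s s' : Fin M) :
    ev y (MvPolynomial.pderiv (j', s') (((gX d M)ᵀ * (gX d M * (gX d M)ᵀ) ^ n) s j)) =
      ∑ k ∈ Finset.range (n + 1), ((yᵀ * y) ^ k) s s' * ((y * yᵀ) ^ (n - k)) j' j +
      ∑ k ∈ Finset.range n, (yᵀ * (y * yᵀ) ^ k) s j' * (yᵀ * (y * yᵀ) ^ (n - 1 - k)) s' j := by
  have h := congrFun (congrFun (deriv_T (MvPolynomial.pderiv (R := ℝ) (j', s')) (gX d M) n) s) j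
  rw [Matrix.map_apply] at h
  rw [h, gX_deriv, Matrix.transpose_single]
  have a1 : ∀ (k : ℕ) (i i' : Fin M), ev y ((((gX d M)ᵀ * gX d M) ^ k) i i') = ((yᵀ * y) ^ k) i i' := by
    intro k i i'
    rw [← ev_G, Matrix.map_apply]
  have a2 : ∀ (k : ℕ) (i i' : Fin d), ev y (((gX d M * (gX d M)ᵀ) ^ k) i i') = ((y * yᵀ) ^ k) i i' := by
    intro k i i'
    rw [← ev_W, Matrix.map_apply]
  have a3 : ∀ (k : ℕ) (i : Fin M) (i' : Fin d), ev y (((gX d M)ᵀ * (gX d M * (gX d M)ᵀ) ^ k) i i') =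
      (yᵀ * (y * yᵀ) ^ k) i i' := by
    intro k i i'
    rw [← ev_T, Matrix.map_apply]
  simp only [Matrix.add_apply, Matrix.sum_apply, mul_single_mul_apply, map_add, map_sum, map_mul,
    a1, a2, a3]

end gen

section main
variable {Ω : Type*} [MeasurableSpace Ω] {P : Measure Ω} [IsProbabilityMeasure P]
    {d M : ℕ} {Y : Ω → Matrix (Fin d) (Fin M) ℝ}
    {A : Fin M → Fin M → Matrix (Fin d) (Fin d) ℝ} {B : Matrix (Fin M) (Fin M) ℝ} {κ : ℝ}

lemma integrable_ev (h : IsCenteredGaussianFamily P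
      (fun p : Fin d × Fin M => fun ω => Y ω p.1 p.2)) (f : MvPolynomial (Fin d × Fin M) ℝ) :
    Integrable (fun ω => ev (Y ω) f) P := integrable_mvpoly h f

lemma integrable_trace (h : IsCenteredGaussianFamily P
      (fun p : Fin d × Fin M => fun ω => Y ω p.1 p.2)) (n : ℕ) :
    Integrable (fun ω => trace ((Y ω * (Y ω)ᵀ) ^ n)) P := by
  have := integrable_ev h (trace ((gX d M * (gX d M)ᵀ) ^ n))
  refine this.congr (Filter.Eventually.of_forall fun ω => ?_)
  simp only [← ev_W, trace, diag_apply, map_sum, Matrix.map_apply]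

lemma pathwise (hB : ∀ s s', B s s' = opNorm (A s s')) (hκ : 0 < κ) (hBκ : opNorm B ≤ κ)
    (y : Matrix (Fin d) (Fin M) ℝ) (n : ℕ) :
    ∑ s, ∑ s', ∑ j, ∑ j', A s s' j j' *
      ev y (MvPolynomial.pderiv (j', s') (((gX d M)ᵀ * (gX d M * (gX d M)ᵀ) ^ n) s j)) ≤
      (2 * n + 1) * (κ * (((d : ℝ) + M) * trace ((y * yᵀ) ^ n))) := by
  have e : ∀ (r : ℕ) (f : ℕ → Fin M → Fin M → Fin d → Fin d → ℝ),
      ∑ s, ∑ s', ∑ j, ∑ j', A s s' j j' * ∑ k ∈ Finset.range r, f k s s' j j' =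
      ∑ k ∈ Finset.range r, ∑ s, ∑ s', ∑ j, ∑ j', A s s' j j' * f k s s' j j' := by
    intro r f
    symm
    rw [Finset.sum_comm]; refine Finset.sum_congr rfl fun s _ => ?_
    rw [Finset.sum_comm]; refine Finset.sum_congr rfl fun s' _ => ?_
    rw [Finset.sum_comm]; refine Finset.sum_congr rfl fun j _ => ?_
    rw [Finset.sum_comm]; refine Finset.sum_congr rfl fun j' _ => ?_
    rw [Finset.mul_sum]
  simp only [ev_deriv_T, mul_add, Finset.sum_add_distrib]
  rw [e (n + 1) (fun k s s' j j' => ((yᵀ * y) ^ k) s s' * ((y * yᵀ) ^ (n - k)) j' j),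
    e n (fun k s s' j j' => (yᵀ * (y * yᵀ) ^ k) s j' * (yᵀ * (y * yᵀ) ^ (n - 1 - k)) s' j)]
  have h1 : ∀ k ∈ Finset.range (n + 1), ∑ s, ∑ s', ∑ j, ∑ j', A s s' j j' *
      (((yᵀ * y) ^ k) s s' * ((y * yᵀ) ^ (n - k)) j' j) ≤ κ * (((d : ℝ) + M) * trace ((y * yᵀ) ^ n)) :=
    fun k hk => by
      have := term1 hB hκ hBκ y k (n - k)
      rwa [show k + (n - k) = n by have := Finset.mem_range.1 hk; omega] at this
  have h2 : ∀ k ∈ Finset.range n, ∑ s, ∑ s', ∑ j, ∑ j', A s s' j j' *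
      ((yᵀ * (y * yᵀ) ^ k) s j' * (yᵀ * (y * yᵀ) ^ (n - 1 - k)) s' j) ≤ κ * (((d : ℝ) + M) * trace ((y * yᵀ) ^ n)) :=
    fun k hk => by
      have := term2 hB hκ hBκ y k (n - 1 - k)
      rwa [show k + (n - 1 - k) + 1 = n by have := Finset.mem_range.1 hk; omega] at this
  refine (add_le_add (Finset.sum_le_sum h1) (Finset.sum_le_sum h2)).trans (le_of_eq ?_)
  simp only [Finset.sum_const, Finset.card_range, nsmul_eq_mul]
  push_cast
  ring

lemma int2 {M d : ℕ} (F : Fin M → Fin d → Ω → ℝ) (hF : ∀ s j, Integrable (F s j) P) :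
    ∫ ω, ∑ s, ∑ j, F s j ω ∂P = ∑ s, ∑ j, ∫ ω, F s j ω ∂P := by
  rw [integral_finsetSum _ fun s _ => integrable_finsetSum _ fun j _ => hF s j]
  refine Finset.sum_congr rfl fun s _ => ?_
  rw [integral_finsetSum _ fun j _ => hF s j]

lemma int4 (A : Fin M → Fin M → Matrix (Fin d) (Fin d) ℝ)
    (F : Fin M → Fin M → Fin d → Fin d → Ω → ℝ) (hF : ∀ s s' j j', Integrable (F s s' j j') P) :
    ∫ ω, ∑ s, ∑ s', ∑ j, ∑ j', A s s' j j' * F s s' j j' ω ∂P =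
      ∑ s, ∑ s', ∑ j, ∑ j', A s s' j j' * ∫ ω, F s s' j j' ω ∂P := by
  rw [int2 (fun s s' ω => ∑ j, ∑ j', A s s' j j' * F s s' j j' ω) fun s s' =>
      integrable_finsetSum _ fun j _ => integrable_finsetSum _ fun j' _ =>
        (hF s s' j j').const_mul _]
  refine Finset.sum_congr rfl fun s _ => Finset.sum_congr rfl fun s' _ => ?_
  rw [int2 (fun j j' ω => A s s' j j' * F s s' j j' ω) fun j j' => (hF s s' j j').const_mul _]
  simp only [integral_const_mul]

lemma moment_eq (h : IsCenteredGaussianFamily P (fun p : Fin d × Fin M => fun ω => Y ω p.1 p.2))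
    (hA : ∀ s s' : Fin M, ∀ j j' : Fin d, A s s' j j' = ∫ ω, (Y ω j s) * (Y ω j' s') ∂P) (n : ℕ) :
    ∫ ω, trace ((Y ω * (Y ω)ᵀ) ^ (n + 1)) ∂P = ∫ ω, ∑ s, ∑ s', ∑ j, ∑ j', A s s' j j' *
      ev (Y ω) (MvPolynomial.pderiv (j', s')
        (((gX d M)ᵀ * (gX d M * (gX d M)ᵀ) ^ n) s j)) ∂P := by
  have hi := fun f : MvPolynomial (Fin d × Fin M) ℝ => integrable_ev h f
  have hprod : ∀ (s : Fin M) (j : Fin d) (f : MvPolynomial (Fin d × Fin M) ℝ),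
      Integrable (fun ω => Y ω j s * ev (Y ω) f) P := by
    intro s j f
    have := hi (MvPolynomial.X (j, s) * f)
    simpa [ev] using this
  have e1 : ∀ ω, trace ((Y ω * (Y ω)ᵀ) ^ (n + 1)) =
      ∑ s, ∑ j, Y ω j s * ev (Y ω) (((gX d M)ᵀ * (gX d M * (gX d M)ᵀ) ^ n) s j) := by
    intro ω
    have : ∀ s j, ev (Y ω) (((gX d M)ᵀ * (gX d M * (gX d M)ᵀ) ^ n) s j) =
        ((Y ω)ᵀ * (Y ω * (Y ω)ᵀ) ^ n) s j := by
      intro s j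
      rw [← ev_T, Matrix.map_apply]
    simp only [this]
    rw [pow_succ', Matrix.mul_assoc, trace, Finset.sum_comm]
    simp only [diag_apply]
    refine Finset.sum_congr rfl fun j _ => ?_
    rw [Matrix.mul_apply]
  simp only [e1]
  rw [int2 (fun s j ω => Y ω j s * ev (Y ω) (((gX d M)ᵀ * (gX d M * (gX d M)ᵀ) ^ n) s j))
    fun s j => hprod s j _]
  rw [int4 A (fun s s' j j' ω => ev (Y ω) (MvPolynomial.pderiv (j', s')
        (((gX d M)ᵀ * (gX d M * (gX d M)ᵀ) ^ n) s j))) fun s s' j j' => hi _]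
  refine Finset.sum_congr rfl fun s _ => ?_
  rw [Finset.sum_comm]
  refine Finset.sum_congr rfl fun j _ => ?_
  have := gaussian_ibp h (j, s) (((gX d M)ᵀ * (gX d M * (gX d M)ᵀ) ^ n) s j)
  refine this.trans ?_
  rw [Fintype.sum_prod_type, Finset.sum_comm]
  refine Finset.sum_congr rfl fun s' _ => Finset.sum_congr rfl fun j' _ => ?_
  rw [hA]
  rfl

lemma moment_succ (h : IsCenteredGaussianFamily P (fun p : Fin d × Fin M => fun ω => Y ω p.1 p.2))
    (hA : ∀ s s' : Fin M, ∀ j j' : Fin d, A s s' j j' = ∫ ω, (Y ω j s) * (Y ω j' s') ∂P)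
    (hB : ∀ s s', B s s' = opNorm (A s s')) (hκ : 0 < κ) (hBκ : opNorm B ≤ κ) (n : ℕ) :
    ∫ ω, trace ((Y ω * (Y ω)ᵀ) ^ (n + 1)) ∂P ≤
      (2 * n + 1) * (κ * (((d : ℝ) + M) * ∫ ω, trace ((Y ω * (Y ω)ᵀ) ^ n) ∂P)) := by
  rw [moment_eq h hA, ← integral_const_mul, ← integral_const_mul, ← integral_const_mul]
  refine integral_mono ?_ ?_ fun ω => pathwise hB hκ hBκ (Y ω) n
  · exact integrable_finsetSum _ fun s _ => integrable_finsetSum _ fun s' _ =>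
      integrable_finsetSum _ fun j _ => integrable_finsetSum _ fun j' _ =>
        (integrable_ev h _).const_mul _
  · exact (((integrable_trace h n).const_mul _).const_mul _).const_mul _

end main
end GramAux

/-- **Trace moment bound for Gaussian Gram matrices.**
Let `Y` be a `d × M` random matrix whose entries are jointly centered real Gaussian.
Let `A s s' = E[Y_{•,s} Y_{•,s'}ᵀ]` be the auto-covariance matrices of its columns and let
`B` be the `M × M` matrix of operator norms `B s s' = ‖A s s'‖`. If `‖B‖ ≤ κ` for some
`κ > 0`, then for all `L ∈ ℕ`,
`E[tr((Y Yᵀ)^L)] ≤ κ^L (2L-1)!! (d+M)^(L+1)`. -/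
theorem trace_moment_bound_gaussian_gram
    {Ω : Type*} [MeasurableSpace Ω] (P : Measure Ω) [IsProbabilityMeasure P]
    (d M : ℕ) (Y : Ω → Matrix (Fin d) (Fin M) ℝ)
    (hGauss : IsCenteredGaussianFamily P
      (fun p : Fin d × Fin M => fun ω => Y ω p.1 p.2))
    (A : Fin M → Fin M → Matrix (Fin d) (Fin d) ℝ)
    (hA : ∀ s s' : Fin M, ∀ j j' : Fin d, A s s' j j' = ∫ ω, (Y ω j s) * (Y ω j' s') ∂P)
    (B : Matrix (Fin M) (Fin M) ℝ)
    (hB : ∀ s s' : Fin M, B s s' = opNorm (A s s'))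
    (κ : ℝ) (hκ : 0 < κ) (hBκ : opNorm B ≤ κ) (L : ℕ) :
    ∫ ω, Matrix.trace ((Y ω * (Y ω)ᵀ) ^ L) ∂P ≤
      κ ^ L * (Nat.doubleFactorial (2 * L - 1) : ℝ) * ((d : ℝ) + M) ^ (L + 1) := by
  induction L with
  | zero => simp
  | succ n ih =>
    refine (GramAux.moment_succ hGauss hA hB hκ hBκ n).trans ?_
    have hdf : (Nat.doubleFactorial (2 * (n + 1) - 1) : ℝ) =
        (2 * n + 1) * (Nat.doubleFactorial (2 * n - 1) : ℝ) := by
      cases n with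
      | zero => simp
      | succ m =>
        rw [show 2 * (m + 1 + 1) - 1 = (2 * (m + 1) - 1) + 2 by omega, Nat.doubleFactorial_add_two,
          show 2 * (m + 1) - 1 + 2 = 2 * (m + 1) + 1 by omega]
        push_cast
        ring
    rw [hdf]
    calc _ ≤ (2 * (n : ℝ) + 1) * (κ * (((d : ℝ) + M) *
          (κ ^ n * (Nat.doubleFactorial (2 * n - 1) : ℝ) * ((d : ℝ) + M) ^ (n + 1)))) := by
          gcongr
      _ = _ := by ring
end

section
/- Wick's formula: for random variables Y_1, ..., Y_{2L} which jointly follow a centered (possibly degenerate) complex Gaussian distribution, E[Y_1 ⋯ Y_{2L}] = Σ_{π ∈ Π₂(2L)} Π_{{a,b} ∈ π} E[Y_a Y_b]. -/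
open MeasureTheory ProbabilityTheory

/-- A finite family of complex random variables jointly follows a centered (possibly
degenerate) complex Gaussian distribution iff the family of all real and imaginary parts is
a centered real Gaussian family. -/
def IsCenteredComplexGaussianFamily {Ω : Type*} [MeasurableSpace Ω] (P : Measure Ω)
    {ι : Type*} [Fintype ι] (Y : ι → Ω → ℂ) : Prop :=
  IsCenteredGaussianFamily P
    (fun p : ι × Bool => fun ω => if p.2 then (Y p.1 ω).re else (Y p.1 ω).im)

/-- A pairing of `{1, ..., n}` is a partition all of whose blocks have cardinality two. -/
def IsPairing {n : ℕ} (π : Finset (Finset (Fin n))) : Prop :=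
  (∀ p ∈ π, p.card = 2) ∧ ∀ i : Fin n, ∃! p, p ∈ π ∧ i ∈ p

open scoped Classical in
noncomputable def pairingsOn {ι : Type*} [Fintype ι] (s : Finset ι) : Finset (Finset (Finset ι)) :=
  Finset.univ.filter (fun π => (∀ p ∈ π, p.card = 2 ∧ p ⊆ s) ∧ ∀ i ∈ s, ∃! p, p ∈ π ∧ i ∈ p)

lemma mem_pairingsOn {ι : Type*} [Fintype ι] {s : Finset ι} {π : Finset (Finset ι)} :
    π ∈ pairingsOn s ↔ (∀ p ∈ π, p.card = 2 ∧ p ⊆ s) ∧ ∀ i ∈ s, ∃! p, p ∈ π ∧ i ∈ p := by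
  simp [pairingsOn]

lemma pairingsOn_empty {ι : Type*} [Fintype ι] : pairingsOn (∅ : Finset ι) = {∅} := by
  classical
  ext π
  rw [mem_pairingsOn, Finset.mem_singleton]
  constructor
  · rintro ⟨h, -⟩
    refine Finset.eq_empty_of_forall_notMem fun p hp => ?_
    obtain ⟨h1, h2⟩ := h p hp
    rw [Finset.subset_empty] at h2
    simp [h2] at h1
  · rintro rfl
    simp

open scoped Classical in
lemma sum_pairingsOn_insert {ι : Type*} [Fintype ι] (f : Finset ι → ℂ) (s : Finset ι) (a : ι)
    (ha : a ∉ s) :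
    ∑ π ∈ pairingsOn (insert a s), ∏ p ∈ π, f p =
      ∑ b ∈ s, f {a, b} * ∑ π ∈ pairingsOn (s.erase b), ∏ p ∈ π, f p := by
  simp_rw [Finset.mul_sum]
  rw [Finset.sum_sigma']
  symm
  have key : ∀ b ∈ s, ∀ π ∈ pairingsOn (s.erase b), ∀ p ∈ π, a ∉ p ∧ b ∉ p := by
    intro b hb π hπ p hp
    have := ((mem_pairingsOn.1 hπ).1 p hp).2
    refine ⟨fun h => ha (Finset.mem_of_mem_erase (this h)), fun h => ?_⟩
    simpa using this h
  refine Finset.sum_bij (fun x _ => insert {a, x.1} x.2) ?_ ?_ ?_ ?_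
  · rintro ⟨b, π⟩ h
    obtain ⟨hb, hπ⟩ := Finset.mem_sigma.1 h
    dsimp at hb hπ ⊢
    have hk := key b hb π hπ
    have hab : a ≠ b := fun h => ha (h ▸ hb)
    rw [mem_pairingsOn] at hπ ⊢
    refine ⟨fun p hp => ?_, fun i hi => ?_⟩
    · rcases Finset.mem_insert.1 hp with rfl | hp
      · refine ⟨Finset.card_pair hab, ?_⟩
        intro x hx
        simp at hx ⊢
        rcases hx with rfl | rfl <;> simp [hb]
      · refine ⟨(hπ.1 p hp).1, ((hπ.1 p hp).2.trans (Finset.erase_subset _ _)).trans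
          (Finset.subset_insert _ _)⟩
    · by_cases hi' : i = a ∨ i = b
      · refine ⟨{a, b}, ⟨by simp, by simpa using hi'⟩, ?_⟩
        rintro p ⟨hp0, hip⟩
        rcases Finset.mem_insert.1 hp0 with rfl | hp
        · rfl
        · exfalso
          rcases hi' with rfl | rfl
          · exact (hk p hp).1 hip
          · exact (hk p hp).2 hip
      · push Not at hi'
        have his : i ∈ s.erase b := by
          simp [hi'.2]; simpa [hi'.1] using hi
        obtain ⟨p, ⟨hp, hip⟩, hu⟩ := hπ.2 i his
        refine ⟨p, ⟨by simp [hp], hip⟩, ?_⟩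
        rintro q ⟨hq, hiq⟩
        rcases Finset.mem_insert.1 hq with rfl | hq
        · simp [hi'.1, hi'.2] at hiq
        · exact hu q ⟨hq, hiq⟩
  · rintro ⟨b, π⟩ h ⟨b', π'⟩ h' heq
    obtain ⟨hb, hπ⟩ := Finset.mem_sigma.1 h
    obtain ⟨hb', hπ'⟩ := Finset.mem_sigma.1 h'
    dsimp at hb hπ hb' hπ' heq
    have hk := key b hb π hπ
    have hk' := key b' hb' π' hπ'
    have h1 : ({a, b} : Finset ι) ∈ insert {a, b'} π' := by rw [← heq]; simp
    have hbb : b = b' := by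
      rcases Finset.mem_insert.1 h1 with h1 | h1
      · have : b ∈ ({a, b'} : Finset ι) := by rw [← h1]; simp
        have hab : b ≠ a := fun h => ha (h ▸ hb)
        simpa [hab] using this
      · exact absurd (by simp) (hk' _ h1).1
    subst hbb
    have n1 : ({a, b} : Finset ι) ∉ π := fun h => (hk _ h).1 (by simp)
    have n2 : ({a, b} : Finset ι) ∉ π' := fun h => (hk' _ h).1 (by simp)
    have : π = π' := by
      rw [← Finset.erase_insert n1, heq, Finset.erase_insert n2]
    rw [this]
  · intro π hπ
    rw [mem_pairingsOn] at hπ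
    obtain ⟨p, ⟨hp, hap⟩, hu⟩ := hπ.2 a (by simp)
    obtain ⟨hc, hsub⟩ := hπ.1 p hp
    obtain ⟨b, hb⟩ : ∃ b, p.erase a = {b} := by
      rw [← Finset.card_eq_one, Finset.card_erase_of_mem hap, hc]
    have hpab : p = {a, b} := by rw [← Finset.insert_erase hap, hb]
    have hba : b ≠ a := by
      have : b ∈ p.erase a := by simp [hb]
      exact Finset.ne_of_mem_erase this
    have hbs : b ∈ s := by
      have : b ∈ insert a s := hsub (by simp [hpab])
      simpa [hba] using this
    refine ⟨⟨b, π.erase p⟩, ?_, ?_⟩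
    · rw [Finset.mem_sigma]
      refine ⟨hbs, ?_⟩
      rw [mem_pairingsOn]
      refine ⟨fun q hq0 => ?_, fun i hi => ?_⟩
      · obtain ⟨hqp, hq⟩ := Finset.mem_erase.1 hq0
        refine ⟨(hπ.1 q hq).1, fun x hx => ?_⟩
        have hxa : x ≠ a := by
          rintro rfl
          exact hqp (hu q ⟨hq, hx⟩)
        have hxb : x ≠ b := by
          rintro rfl
          exact hqp ((hπ.2 x (by simp [hbs])).unique ⟨hq, hx⟩ ⟨hp, by simp [hpab]⟩)
        have := (hπ.1 q hq).2 hx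
        simp [hxa] at this
        simp [hxb, this]
      · obtain ⟨hib, his⟩ := Finset.mem_erase.1 hi
        have hia : i ≠ a := fun h => ha (h ▸ his)
        obtain ⟨q, ⟨hq, hiq⟩, huq⟩ := hπ.2 i (by simp [his])
        refine ⟨q, ⟨Finset.mem_erase.2 ⟨?_, hq⟩, hiq⟩, ?_⟩
        · rintro rfl
          simp [hpab, hia, hib] at hiq
        · rintro r ⟨hr, hir⟩
          exact huq r ⟨Finset.mem_of_mem_erase hr, hir⟩
    · dsimp
      rw [← hpab, Finset.insert_erase hp]
  · rintro ⟨b, π⟩ h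
    obtain ⟨hb, hπ⟩ := Finset.mem_sigma.1 h
    dsimp at hb hπ ⊢
    have hk := key b hb π hπ
    have n1 : ({a, b} : Finset ι) ∉ π := fun h => (hk _ h).1 (by simp)
    rw [Finset.prod_insert n1]



lemma integrable_pow_gaussian (v : NNReal) (k : ℕ) :
    Integrable (fun x : ℝ => x ^ k) (gaussianReal 0 v) := by
  have := (memLp_id_gaussianReal (μ := 0) (v := v) k).integrable_norm_pow'
  refine (integrable_norm_iff (by fun_prop)).1 ?_
  simpa using this

lemma integrable_gaussian_density {v : NNReal} (hv : v ≠ 0) (f : ℝ → ℝ)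
    (hf : Integrable f (gaussianReal 0 v)) :
    Integrable (fun x => f x * gaussianPDFReal 0 v x) := by
  rw [gaussianReal_of_var_ne_zero _ hv, integrable_withDensity_iff_integrable_smul'
    (by fun_prop) (by simp [gaussianPDF])] at hf
  simpa [toReal_gaussianPDF, mul_comm] using hf

lemma hasDerivAt_gaussianPDFReal {v : NNReal} (hv : v ≠ 0) (x : ℝ) :
    HasDerivAt (gaussianPDFReal 0 v) (-(x / v) * gaussianPDFReal 0 v x) x := by
  have hv' : (v : ℝ) ≠ 0 := by exact_mod_cast hv
  have h : HasDerivAt (fun x : ℝ => -(x - 0) ^ 2 / (2 * v)) (-(x / v)) x := by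
    refine ((((hasDerivAt_id' x).sub_const 0).fun_pow 2).fun_neg.div_const
      (2 * (v : ℝ))).congr_deriv ?_
    field_simp
    simp [mul_comm]
  rw [gaussianPDFReal_def]
  refine ((h.exp).const_mul (√(2 * Real.pi * v))⁻¹).congr_deriv ?_
  ring

lemma gaussian_moment_rec (v : NNReal) (k : ℕ) :
    ∫ x, x ^ (k + 1) ∂(gaussianReal 0 v) = v * (k * ∫ x, x ^ (k - 1) ∂(gaussianReal 0 v)) := by
  by_cases hv : v = 0
  · subst hv
    simp [gaussianReal_zero_var]
  have hv' : (v : ℝ) ≠ 0 := by exact_mod_cast hv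
  rw [integral_gaussianReal_eq_integral_smul hv, integral_gaussianReal_eq_integral_smul hv]
  have h1 := integrable_gaussian_density hv _ (integrable_pow_gaussian v (k+1))
  have h2 := integrable_gaussian_density hv _ (integrable_pow_gaussian v (k-1))
  have h3 := integrable_gaussian_density hv _ (integrable_pow_gaussian v k)
  have := integral_mul_deriv_eq_deriv_mul_of_integrable
    (u := fun x : ℝ => x ^ k) (u' := fun x : ℝ => k * x ^ (k - 1))
    (v := gaussianPDFReal 0 v) (v' := fun x => -(x / v) * gaussianPDFReal 0 v x)
    (fun x _ => hasDerivAt_pow k x) (fun x _ => hasDerivAt_gaussianPDFReal hv x)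
    (by
      convert h1.const_mul (-(1 / (v : ℝ))) using 1
      ext x; simp; ring)
    (by
      convert h2.const_mul (k : ℝ) using 1
      ext x; simp; ring) h3
  have e1 : ∀ x : ℝ, x ^ k * (-(x / v) * gaussianPDFReal 0 v x) =
    (-(1 / (v : ℝ))) * (gaussianPDFReal 0 v x • x ^ (k + 1)) := by
    intro x; simp; ring
  have e2 : ∀ x : ℝ, k * x ^ (k - 1) * gaussianPDFReal 0 v x =
    k * (gaussianPDFReal 0 v x • x ^ (k - 1)) := by
    intro x; simp; ring
  simp_rw [e1, e2, integral_const_mul] at this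
  field_simp at this
  linarith

lemma integrable_poly_gaussian (v : NNReal) (p : Polynomial ℂ) :
    Integrable (fun x : ℝ => p.eval (x : ℂ)) (gaussianReal 0 v) := by
  simp_rw [Polynomial.eval_eq_sum_range]
  refine integrable_finsetSum _ fun k _ => ?_
  refine Integrable.const_mul ?_ _
  have := (integrable_pow_gaussian v k).ofReal (𝕜 := ℂ)
  simpa using this

lemma gaussian_stein_poly (v : NNReal) (p : Polynomial ℂ) :
    ∫ x : ℝ, (x : ℂ) * p.eval (x : ℂ) ∂(gaussianReal 0 v) =
      v * ∫ x : ℝ, p.derivative.eval (x : ℂ) ∂(gaussianReal 0 v) := by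
  induction p using Polynomial.induction_on' with
  | add p q hp hq =>
    simp only [Polynomial.eval_add, Polynomial.derivative_add, mul_add]
    have hX : ∀ p : Polynomial ℂ,
        Integrable (fun x : ℝ => (x : ℂ) * p.eval (x : ℂ)) (gaussianReal 0 v) := by
      intro p
      refine (integrable_poly_gaussian v (Polynomial.X * p)).congr (ae_of_all _ fun x => ?_)
      simp
    rw [integral_add (hX p) (hX q), hp, hq, integral_add (integrable_poly_gaussian v _)
      (integrable_poly_gaussian v _)]
    ring
  | monomial n a =>
    simp only [Polynomial.derivative_monomial, Polynomial.eval_monomial]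
    have h := congrArg (fun x : ℝ => (x : ℂ)) (gaussian_moment_rec v n)
    simp only [Complex.ofReal_mul, ← integral_complex_ofReal, Complex.ofReal_pow] at h
    have e1 : ∀ x : ℝ, (x : ℂ) * (a * (x : ℂ) ^ n) = a * (x : ℂ) ^ (n + 1) := by
      intro x; ring
    simp_rw [e1, integral_const_mul, h]
    push_cast
    ring

lemma memLp_two_prod {Ω ι : Type*} [MeasurableSpace Ω] {P : Measure Ω} [IsProbabilityMeasure P]
    (Y : ι → Ω → ℂ) (h : ∀ i, ∀ p : ENNReal, p ≠ ⊤ → MemLp (Y i) p P) (s : Finset ι) :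
    MemLp (fun ω => ∏ i ∈ s, Y i ω) 2 P := by
  have := MemLp.prod' (s := s) (f := Y) (p := fun _ => 2 * (s.card + 1 : ENNReal)) (μ := P)
    (fun i _ => h i _ (by finiteness))
  refine this.mono_exponent ?_
  rw [ENNReal.le_inv_iff_le_inv]
  simp only [Finset.sum_const, nsmul_eq_mul]
  rw [ENNReal.mul_inv (by simp) (by simp), mul_left_comm]
  refine mul_le_of_le_one_right (by simp) ?_
  rw [← div_eq_mul_inv]
  refine ENNReal.div_le_of_le_mul ?_
  simp

open scoped Classical in
lemma stein_indep {Ω ι : Type*} [MeasurableSpace Ω] [Fintype ι] {P : Measure Ω}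
    [IsProbabilityMeasure P] (v : NNReal) (X : Ω → ℝ) (Z : ι → Ω → ℂ) (a : ι → ℂ)
    (hXm : AEMeasurable X P) (hX : P.map X = gaussianReal 0 v)
    (hZm : AEMeasurable (fun ω i => Z i ω) P)
    (hI : IndepFun X (fun ω i => Z i ω) P) (s : Finset ι)
    (h1 : Integrable (fun ω => (X ω : ℂ) * ∏ i ∈ s, (a i * X ω + Z i ω)) P)
    (h2 : ∀ t : Finset ι, Integrable (fun ω => ∏ i ∈ t, (a i * X ω + Z i ω)) P) :
    ∫ ω, (X ω : ℂ) * ∏ i ∈ s, (a i * X ω + Z i ω) ∂P =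
      ∑ j ∈ s, v * a j * ∫ ω, ∏ i ∈ s.erase j, (a i * X ω + Z i ω) ∂P := by
  set ν := P.map (fun ω i => Z i ω) with hν
  have hν' : IsProbabilityMeasure ν := Measure.isProbabilityMeasure_map hZm
  have hmap := (indepFun_iff_map_prod_eq_prod_map_map hXm hZm).1 hI
  rw [hX] at hmap
  have hm : AEMeasurable (fun ω => (X ω, fun i => Z i ω)) P := hXm.prodMk hZm
  let F : Finset ι → ℝ × (ι → ℂ) → ℂ := fun t q => ∏ i ∈ t, (a i * q.1 + q.2 i)
  let G : ℝ × (ι → ℂ) → ℂ := fun q => (q.1 : ℂ) * F s q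
  have hFm : ∀ t, Continuous (F t) := fun t => by
    simp only [F]; fun_prop
  have hGm : Continuous G := by
    simp only [G, F]; fun_prop
  have hFi : ∀ t, Integrable (F t) ((gaussianReal 0 v).prod ν) := fun t => by
    rw [← hmap]
    exact (integrable_map_measure (hFm t).aestronglyMeasurable hm).2 (h2 t)
  have hGi : Integrable G ((gaussianReal 0 v).prod ν) := by
    rw [← hmap]
    exact (integrable_map_measure hGm.aestronglyMeasurable hm).2 h1
  have eF : ∀ t, ∫ ω, ∏ i ∈ t, (a i * X ω + Z i ω) ∂P = ∫ q, F t q ∂((gaussianReal 0 v).prod ν) := by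
    intro t
    rw [← hmap, integral_map hm (hFm t).aestronglyMeasurable]
  have eG : ∫ ω, (X ω : ℂ) * ∏ i ∈ s, (a i * X ω + Z i ω) ∂P
      = ∫ q, G q ∂((gaussianReal 0 v).prod ν) := by
    rw [← hmap, integral_map hm hGm.aestronglyMeasurable]
  simp_rw [eF, eG]
  rw [integral_prod_symm _ hGi]
  have hinner : ∀ z : ι → ℂ, ∫ x, G (x, z) ∂(gaussianReal 0 v) =
      ∫ x, ∑ j ∈ s, v * a j * F (s.erase j) (x, z) ∂(gaussianReal 0 v) := by
    intro z
    have := gaussian_stein_poly v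
      (∏ i ∈ s, (Polynomial.C (a i) * Polynomial.X + Polynomial.C (z i)))
    rw [Polynomial.derivative_prod_finset, ← integral_const_mul] at this
    simp only [Polynomial.eval_prod, Polynomial.eval_add, Polynomial.eval_mul, Polynomial.eval_C,
      Polynomial.eval_X, Polynomial.eval_finsetSum, Polynomial.derivative_add,
      Polynomial.derivative_C_mul, Polynomial.derivative_C, Polynomial.derivative_X, mul_one,
      add_zero, Finset.mul_sum] at this
    simp only [G, F]
    rw [this]
    congr 1
    ext x
    refine Finset.sum_congr rfl fun j _ => ?_
    ring
  simp_rw [hinner]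
  have hS : Integrable (fun q => ∑ j ∈ s, v * a j * F (s.erase j) q)
      ((gaussianReal 0 v).prod ν) :=
    integrable_finsetSum _ fun j _ => (hFi _).const_mul _
  rw [← integral_prod_symm _ hS, integral_finsetSum _ fun j _ => (hFi _).const_mul _]
  simp_rw [integral_const_mul]

open scoped Classical in
lemma stein_real {Ω ι : Type*} [MeasurableSpace Ω] [Fintype ι] {P : Measure Ω}
    [IsProbabilityMeasure P] (Y : ι → Ω → ℂ) (hY : HasGaussianLaw (fun ω i => Y i ω) P)
    (h0 : ∀ l : (ι → ℂ) →L[ℝ] ℝ, ∫ ω, l (fun i => Y i ω) ∂P = 0)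
    (L : (ι → ℂ) →L[ℝ] ℝ) (s : Finset ι) :
    ∫ ω, (L (fun i => Y i ω) : ℂ) * ∏ i ∈ s, Y i ω ∂P =
      ∑ j ∈ s, (∫ ω, (L (fun i => Y i ω) : ℂ) * Y j ω ∂P) * ∫ ω, ∏ i ∈ s.erase j, Y i ω ∂P := by
  set X : Ω → ℝ := fun ω => L (fun i => Y i ω) with hXdef
  have hXg : HasGaussianLaw X P := hY.map_fun L
  have hXlaw := hXg.map_eq_gaussianReal
  set v := Var[X; P].toNNReal with hv
  rw [show ∫ ω, X ω ∂P = 0 from h0 L] at hXlaw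
  have hYL : ∀ i, ∀ p : ENNReal, p ≠ ⊤ → MemLp (Y i) p P := fun i p hp =>
    (hY.eval i).memLp hp
  have hP2 := memLp_two_prod Y hYL
  have hX2 : MemLp X 2 P := hXg.memLp_two
  have hX2c : MemLp (fun ω => (X ω : ℂ)) 2 P := hX2.ofReal
  by_cases hv0 : v = 0
  · have hX0 : X =ᵐ[P] 0 := by
      rw [hv0, gaussianReal_zero_var] at hXlaw
      have : ∀ᵐ x ∂(P.map X), x = 0 := by
        rw [hXlaw, ae_dirac_eq]; simp
      exact ae_of_ae_map hXg.aemeasurable this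
    have e : ∀ f : Ω → ℂ, ∫ ω, (X ω : ℂ) * f ω ∂P = 0 := by
      intro f
      rw [integral_congr_ae (g := fun _ => (0 : ℂ)), integral_zero]
      filter_upwards [hX0] with ω hω
      simp [hω]
    rw [e]
    symm
    refine Finset.sum_eq_zero fun j _ => ?_
    rw [e, zero_mul]
  have hvar : (v : ℝ) = ∫ ω, X ω * X ω ∂P := by
    rw [hv, Real.coe_toNNReal _ (variance_nonneg _ _), ← covariance_self hXg.aemeasurable,
      covariance_eq_sub hX2 hX2, show ∫ ω, X ω ∂P = 0 from h0 L]
    simp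
  have hvne : (v : ℝ) ≠ 0 := by exact_mod_cast hv0
  have hY2 : MemLp (fun ω i => Y i ω) 2 P := hY.memLp_two
  have hXY : Integrable (fun ω => X ω • (fun i => Y i ω)) P := by
    exact memLp_one_iff_integrable.1 (hY2.smul hX2)
  set a : ι → ℂ := (v : ℝ)⁻¹ • ∫ ω, X ω • (fun i => Y i ω) ∂P with ha
  have hai : ∀ i, (v : ℂ) * a i = ∫ ω, (X ω : ℂ) * Y i ω ∂P := by
    intro i
    have := (ContinuousLinearMap.proj (R := ℝ) (φ := fun _ : ι => ℂ) i).integral_comp_comm hXY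
    simp at this
    simp only [ha, Pi.smul_apply, ← this]
    rw [Complex.real_smul, ← mul_assoc]
    have : (v : ℂ) ≠ 0 := by exact_mod_cast hv0
    push_cast
    rw [show (((v : ℝ) : ℂ)) = v from rfl, mul_inv_cancel₀ this, one_mul]
  let Z : ι → Ω → ℂ := fun i ω => Y i ω - a i * X ω
  let T : (ι → ℂ) →L[ℝ] ℝ × (ι → ℂ) :=
    L.prod (ContinuousLinearMap.id ℝ _ - L.smulRight a)
  have hT : ∀ ω, T (fun i => Y i ω) = (X ω, fun i => Z i ω) := by
    intro ω
    ext i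
    · rfl
    · simp [T, Z, X, mul_comm]
  have hj : HasGaussianLaw (fun ω => (X ω, fun i => Z i ω)) P := by
    have := hY.map_fun T
    simpa only [hT] using this
  have hI : IndepFun X (fun ω i => Z i ω) P := by
    refine hj.indepFun_of_covariance_strongDual fun L₁ L₂ => ?_
    have e1 : L₁ ∘ X = fun ω => L₁ 1 * X ω := by
      ext ω
      have := L₁.map_smul (X ω) 1
      simp at this
      simp [this, mul_comm]
    have e2 : L₂ ∘ (fun ω i => Z i ω) = fun ω => L₂ (fun i => Y i ω) - L₂ a * X ω := by
      ext ω
      have : (fun i => Z i ω) = (fun i => Y i ω) - X ω • a := by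
        ext i; simp [Z, mul_comm]
      simp [this, mul_comm]
    have hl2 : MemLp (fun ω => L₂ (fun i => Y i ω)) 2 P := (hY.map_fun L₂).memLp_two
    rw [e1, e2, covariance_const_mul_left]
    have hm : MemLp (fun ω => L₂ (fun i => Y i ω) - L₂ a * X ω) 2 P :=
      hl2.sub (hX2.const_mul _)
    rw [covariance_eq_sub hX2 hm, show ∫ ω, X ω ∂P = 0 from h0 L]
    have hc := L₂.integral_comp_comm hXY
    have hi1 : Integrable (fun ω => X ω * L₂ (fun i => Y i ω)) P := hX2.integrable_mul hl2
    have hi2 : Integrable (fun ω => X ω * X ω) P := hX2.integrable_mul hX2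
    have e3 : ∀ ω, (X * fun ω => L₂ (fun i => Y i ω) - L₂ a * X ω) ω =
        X ω * L₂ (fun i => Y i ω) - L₂ a * (X ω * X ω) := by
      intro ω; simp; ring
    simp_rw [e3]
    rw [integral_sub hi1 (hi2.const_mul _), integral_const_mul, ← hvar]
    simp only [map_smul, smul_eq_mul] at hc
    rw [hc, ha]
    simp only [map_smul, smul_eq_mul]
    field_simp
    simp [mul_comm]
  have hYZ : ∀ i ω, a i * X ω + Z i ω = Y i ω := by
    intro i ω; simp [Z]
  have := stein_indep v X Z a hXg.aemeasurable hXlaw hj.snd.aemeasurable hI s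
    (by simp only [hYZ]; exact hX2c.integrable_mul (hP2 s))
    (by intro t; simp only [hYZ]; exact (hP2 t).integrable (by norm_num))
  simp only [hYZ, hai] at this
  exact this

open scoped Classical in
lemma stein_complex {Ω ι : Type*} [MeasurableSpace Ω] [Fintype ι] {P : Measure Ω}
    [IsProbabilityMeasure P] (Y : ι → Ω → ℂ) (hY : HasGaussianLaw (fun ω i => Y i ω) P)
    (h0 : ∀ l : (ι → ℂ) →L[ℝ] ℝ, ∫ ω, l (fun i => Y i ω) ∂P = 0)
    (k : ι) (s : Finset ι) :
    ∫ ω, Y k ω * ∏ i ∈ s, Y i ω ∂P =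
      ∑ j ∈ s, (∫ ω, Y k ω * Y j ω ∂P) * ∫ ω, ∏ i ∈ s.erase j, Y i ω ∂P := by
  have hYL : ∀ i, ∀ p : ENNReal, p ≠ ⊤ → MemLp (Y i) p P := fun i p hp =>
    (hY.eval i).memLp hp
  have hP2 := memLp_two_prod Y hYL
  have hre := stein_real Y hY h0
    (Complex.reCLM ∘L ContinuousLinearMap.proj (R := ℝ) (φ := fun _ : ι => ℂ) k) s
  have him := stein_real Y hY h0
    (Complex.imCLM ∘L ContinuousLinearMap.proj (R := ℝ) (φ := fun _ : ι => ℂ) k) s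
  simp only [ContinuousLinearMap.comp_apply, ContinuousLinearMap.proj_apply, Complex.reCLM_apply,
    Complex.imCLM_apply] at hre him
  have hr2 : MemLp (fun ω => ((Y k ω).re : ℂ)) 2 P :=
    MemLp.ofReal (hYL k 2 (by simp)).re
  have hi2 : MemLp (fun ω => ((Y k ω).im : ℂ)) 2 P :=
    MemLp.ofReal (hYL k 2 (by simp)).im
  have split : ∀ f : Ω → ℂ, MemLp f 2 P → ∫ ω, Y k ω * f ω ∂P =
      ∫ ω, ((Y k ω).re : ℂ) * f ω ∂P + Complex.I * ∫ ω, ((Y k ω).im : ℂ) * f ω ∂P := by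
    intro f hf
    have i1 : Integrable (fun ω => ((Y k ω).re : ℂ) * f ω) P := hr2.integrable_mul hf
    have i2 : Integrable (fun ω => ((Y k ω).im : ℂ) * f ω) P := hi2.integrable_mul hf
    rw [← integral_const_mul, ← integral_add i1 (i2.const_mul _)]
    congr 1
    ext ω
    nth_rw 1 [← Complex.re_add_im (Y k ω)]
    ring
  rw [split _ (hP2 s), hre, him, Finset.mul_sum, ← Finset.sum_add_distrib]
  refine Finset.sum_congr rfl fun j _ => ?_
  rw [split _ (hYL j 2 (by simp))]
  ring

lemma hasGaussianLaw_of_family {Ω ι : Type*} [MeasurableSpace Ω] [Fintype ι] {P : Measure Ω}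
    [IsProbabilityMeasure P] (Y : ι → Ω → ℂ)
    (h : ∀ c : ι × Bool → ℝ, ∃ v : NNReal,
      P.map (fun ω => ∑ p, c p * (if p.2 then (Y p.1 ω).re else (Y p.1 ω).im)) =
        gaussianReal 0 v) :
    HasGaussianLaw (fun ω i => Y i ω) P ∧
      ∀ l : (ι → ℂ) →L[ℝ] ℝ, ∫ ω, l (fun i => Y i ω) ∂P = 0 := by
  classical
  have hl : ∀ l : (ι → ℂ) →L[ℝ] ℝ, ∃ v : NNReal,
      P.map (fun ω => l (fun i => Y i ω)) = gaussianReal 0 v := by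
    intro l
    obtain ⟨v, hv⟩ := h (fun p => l (Pi.single p.1 (if p.2 then 1 else Complex.I)))
    refine ⟨v, ?_⟩
    rw [← hv]
    congr 1
    ext ω
    have : (fun i => Y i ω) = ∑ i, ((Y i ω).re • (Pi.single i (1 : ℂ) : ι → ℂ) +
        (Y i ω).im • (Pi.single i Complex.I : ι → ℂ)) := by
      ext j
      simp [Finset.sum_apply, Pi.single_apply, Finset.sum_add_distrib]
    rw [this, map_sum, Fintype.sum_prod_type]
    refine Finset.sum_congr rfl fun i _ => ?_
    simp [mul_comm]
  have haem : ∀ (f : Ω → ℝ) (v : NNReal), P.map f = gaussianReal 0 v → AEMeasurable f P := by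
    intro f v hf
    by_contra hn
    rw [Measure.map_of_not_aemeasurable hn] at hf
    have : IsProbabilityMeasure (0 : Measure ℝ) := by rw [hf]; infer_instance
    exact this.ne_zero 0 rfl
  have hm : AEMeasurable (fun ω i => Y i ω) P := by
    refine aemeasurable_pi_lambda _ fun i => ?_
    obtain ⟨v, hv⟩ := hl (Complex.reCLM ∘L ContinuousLinearMap.proj (R := ℝ) (φ := fun _ : ι => ℂ) i)
    obtain ⟨w, hw⟩ := hl (Complex.imCLM ∘L ContinuousLinearMap.proj (R := ℝ) (φ := fun _ : ι => ℂ) i)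
    have h1 := haem _ _ hv
    have h2 := haem _ _ hw
    simp only [ContinuousLinearMap.comp_apply, ContinuousLinearMap.proj_apply, Complex.reCLM_apply,
      Complex.imCLM_apply] at h1 h2
    have := (Complex.measurable_ofReal.comp_aemeasurable h1).add
      ((Complex.measurable_ofReal.comp_aemeasurable h2).mul_const Complex.I)
    convert this using 1
    ext ω
    exact (Complex.re_add_im _).symm
  refine ⟨⟨isGaussian_of_map_eq_gaussianReal fun l => ?_⟩, fun l => ?_⟩
  · obtain ⟨v, hv⟩ := hl l
    refine ⟨0, v, ?_⟩
    rw [AEMeasurable.map_map_of_aemeasurable (by fun_prop) hm]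
    exact hv
  · obtain ⟨v, hv⟩ := hl l
    have := integral_map (haem _ _ hv) (f := fun x : ℝ => x) (by fun_prop)
    rw [hv, integral_id_gaussianReal] at this
    exact this.symm

open scoped Classical in
lemma wick_finset {Ω ι : Type*} [MeasurableSpace Ω] [Fintype ι] {P : Measure Ω}
    [IsProbabilityMeasure P] (Y : ι → Ω → ℂ) (hY : HasGaussianLaw (fun ω i => Y i ω) P)
    (h0 : ∀ l : (ι → ℂ) →L[ℝ] ℝ, ∫ ω, l (fun i => Y i ω) ∂P = 0) (n : ℕ) :
    ∀ s : Finset ι, s.card = n → ∫ ω, ∏ i ∈ s, Y i ω ∂P =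
      ∑ π ∈ pairingsOn s, ∏ p ∈ π, ∫ ω, ∏ i ∈ p, Y i ω ∂P := by
  induction n using Nat.strong_induction_on with
  | _ n ih =>
    intro s hs
    rcases s.eq_empty_or_nonempty with rfl | ⟨a, ha⟩
    · simp [pairingsOn_empty]
    · obtain ⟨t, hat, rfl⟩ : ∃ t, a ∉ t ∧ s = insert a t :=
        ⟨s.erase a, by simp, (Finset.insert_erase ha).symm⟩
      rw [Finset.card_insert_of_notMem hat] at hs
      rw [sum_pairingsOn_insert _ t a hat]
      simp_rw [Finset.prod_insert hat]
      rw [stein_complex Y hY h0 a t]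
      refine Finset.sum_congr rfl fun b hb => ?_
      have hab : a ≠ b := fun h => hat (h ▸ hb)
      rw [ih (t.erase b).card (by rw [Finset.card_erase_of_mem hb]; omega) _ rfl]
      simp_rw [Finset.prod_pair hab]


open scoped Classical in
/-- **Wick's formula.** For random variables `Y 1, ..., Y (2L)` which jointly follow a
centered (possibly degenerate) complex Gaussian distribution,
`E[Y 1 ⋯ Y (2L)] = ∑_{π pairing of {1,...,2L}} ∏_{{a,b} ∈ π} E[Y a * Y b]`. -/
theorem wick_formula
    {Ω : Type*} [MeasurableSpace Ω] (P : Measure Ω) [IsProbabilityMeasure P]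
    (L : ℕ) (Y : Fin (2 * L) → Ω → ℂ)
    (hGauss : IsCenteredComplexGaussianFamily P Y) :
    ∫ ω, ∏ i, Y i ω ∂P =
      ∑ π ∈ Finset.univ.filter (fun π : Finset (Finset (Fin (2 * L))) => IsPairing π),
        ∏ p ∈ π, ∫ ω, ∏ i ∈ p, Y i ω ∂P := by
  obtain ⟨hY, h0⟩ := hasGaussianLaw_of_family Y hGauss
  have h := wick_finset Y hY h0 _ Finset.univ rfl
  have he : pairingsOn (Finset.univ : Finset (Fin (2 * L))) =
      Finset.univ.filter (fun π : Finset (Finset (Fin (2 * L))) => IsPairing π) := by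
    ext π
    rw [mem_pairingsOn, Finset.mem_filter]
    simp [IsPairing]
  rw [h, he]
end

section
/- Marchenko–Pastur equation: for every c > 0 and every compactly supported probability measure H on [0,∞), there exists a compactly supported probability measure ν on [0,∞), unique among such measures, whose Stieltjes transform satisfies m_ν(z) = ∫_ℝ 1/(λ(1 − c − c z m_ν(z)) − z) dH(λ) for all z ∈ ℂ⁺. -/
open MeasureTheory

/-- The Stieltjes transform of a measure `μ` on `ℝ`, evaluated at `z`. -/
noncomputable def stieltjesTransform (μ : Measure ℝ) (z : ℂ) : ℂ :=
  ∫ x, ((x : ℂ) - z)⁻¹ ∂μ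


lemma mp_spectral {ι : Type} [Fintype ι] [DecidableEq ι] (D v : ι → ℝ) (hD : ∀ i, 0 ≤ D i) :
    ∃ (θ : ι → ℝ) (u : ι → ι → ℝ), (∀ k, 0 ≤ θ k) ∧
      (∀ i j, ∑ k, u k i * u k j = if i = j then 1 else 0) ∧
      (∀ k, ∑ i, u k i * u k i = 1) ∧
      (∀ k i, D i * u k i + v i * ∑ j, v j * u k j = θ k * u k i) := by
  set A : Matrix ι ι ℝ := Matrix.diagonal D + Matrix.vecMulVec v (star v) with hA
  have hpos : A.PosSemidef :=
    (Matrix.PosSemidef.diagonal hD).add (Matrix.posSemidef_vecMulVec_self_star v)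
  have hH := hpos.isHermitian
  refine ⟨hH.eigenvalues, fun k i => hH.eigenvectorBasis k i, hpos.eigenvalues_nonneg, ?_, ?_, ?_⟩
  · intro i j
    have := congrFun (congrFun (Unitary.coe_mul_star_self hH.eigenvectorUnitary) i) j
    rw [Matrix.mul_apply] at this
    simpa [Matrix.one_apply, Matrix.star_apply] using this
  · intro k
    have := hH.eigenvectorBasis.orthonormal.1 k
    have h2 : ‖hH.eigenvectorBasis k‖ ^ 2 = 1 := by rw [this]; norm_num
    rw [EuclideanSpace.norm_sq_eq] at h2
    rw [← h2]
    refine Finset.sum_congr rfl fun i _ => ?_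
    rw [Real.norm_eq_abs, sq_abs, sq]
  · intro k i
    have gen : ∀ w : ι → ℝ, A.mulVec w i = D i * w i + v i * ∑ j, v j * w j := by
      intro w
      rw [hA, Matrix.add_mulVec, Pi.add_apply, Matrix.mulVec_diagonal]
      simp only [Matrix.mulVec, dotProduct, Matrix.vecMulVec_apply]
      rw [Finset.mul_sum]
      congr 1
      refine Finset.sum_congr rfl fun j _ => ?_
      simp [mul_assoc]
    have := congrFun (hH.mulVec_eigenvectorBasis k) i
    rw [gen] at this
    exact this

lemma mp_resolvent {J : Type} [Fintype J] [DecidableEq J] (D v : Option J → ℝ) (h0 : D none = 0)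
    (θ : Option J → ℝ) (u : Option J → Option J → ℝ)
    (ho : ∀ i j, ∑ k, u k i * u k j = if i = j then 1 else 0)
    (he : ∀ k i, D i * u k i + v i * ∑ j, v j * u k j = θ k * u k i)
    (z : ℂ) (hz : ∀ i, (D i : ℂ) - z ≠ 0) (hθ : ∀ k, (θ k : ℂ) - z ≠ 0) :
    (∑ k, (u k none : ℂ) * u k none / (θ k - z)) *
      ((v none : ℂ) ^ 2 - z * (1 + ∑ j : J, (v (some j) : ℂ) ^ 2 / (D (some j) - z))) =
      1 + ∑ j : J, (v (some j) : ℂ) ^ 2 / (D (some j) - z) := by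
  set g : Option J → ℂ := fun i => ∑ k, (u k i : ℂ) * u k none / (θ k - z) with hg
  set s : ℂ := ∑ j, (v j : ℂ) * g j with hs
  have hs' : s = ∑ k, ((∑ j, v j * u k j : ℝ) : ℂ) * u k none / (θ k - z) := by
    rw [hs]; simp only [hg, Finset.mul_sum]
    rw [Finset.sum_comm]
    refine Finset.sum_congr rfl fun k _ => ?_
    push_cast
    rw [Finset.sum_mul, Finset.sum_div]
    refine Finset.sum_congr rfl fun j _ => ?_
    ring
  have key : ∀ i, ((D i : ℂ) - z) * g i + v i * s = if i = none then 1 else 0 := by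
    intro i
    have h1 : ((∑ k, u k i * u k none : ℝ) : ℂ) = if i = none then 1 else 0 := by
      rw [ho]; split_ifs <;> simp
    rw [← h1, hs', hg]
    push_cast
    rw [Finset.mul_sum, Finset.mul_sum, ← Finset.sum_add_distrib]
    refine Finset.sum_congr rfl fun k _ => ?_
    have h2 : (D i : ℂ) * u k i + v i * ((∑ j, v j * u k j : ℝ) : ℂ) = θ k * u k i := by
      exact_mod_cast he k i
    push_cast at h2
    have := hθ k
    field_simp
    linear_combination (u k none : ℂ) * h2
  have k0 := key none
  have hsum : s = v none * g none - s * ∑ j : J, (v (some j) : ℂ) ^ 2 / (D (some j) - z) := by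
    conv_lhs => rw [hs, Fintype.sum_option]
    rw [sub_eq_add_neg, Finset.mul_sum _ _ s, ← Finset.sum_neg_distrib]
    congr 1
    refine Finset.sum_congr rfl fun j _ => ?_
    have kj := key (some j)
    have := hz (some j)
    simp only [reduceCtorEq, if_false] at kj
    field_simp
    linear_combination (v (some j) : ℂ) * kj
  simp only [h0, if_true] at k0
  push_cast at k0
  change g none * _ = _
  set h := ∑ j : J, (v (some j) : ℂ) ^ 2 / (D (some j) - z)
  linear_combination (1 + h) * k0 - v none * hsum

lemma mp_eig_lt {ι : Type} [Fintype ι] (D v : ι → ℝ) (K : ℝ)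
    (hDK : ∀ i, D i < K) (hv : ∑ i, v i ^ 2 / (K - D i) < 1)
    (θ : ℝ) (u : ι → ℝ) (hu : ∑ i, u i * u i = 1)
    (he : ∀ i, D i * u i + v i * ∑ j, v j * u j = θ * u i) : θ < K := by
  by_contra hlt
  push Not at hlt
  set s := ∑ j, v j * u j with hs
  have hu' : ∀ i, u i = v i * s / (θ - D i) := by
    intro i
    have h1 : 0 < θ - D i := by linarith [hDK i]
    rw [eq_div_iff h1.ne']
    linarith [he i]
  have h3 : s = s * ∑ i, v i ^ 2 / (θ - D i) := by
    conv_lhs => rw [hs]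
    rw [Finset.mul_sum]
    refine Finset.sum_congr rfl fun i _ => ?_
    rw [hu' i]; ring
  have h4 : ∑ i, v i ^ 2 / (θ - D i) ≤ ∑ i, v i ^ 2 / (K - D i) := by
    refine Finset.sum_le_sum fun i _ => ?_
    have := hDK i
    apply div_le_div_of_nonneg_left (sq_nonneg _) (by linarith) (by linarith)
  have h5 : s = 0 := by
    have : s * (1 - ∑ i, v i ^ 2 / (θ - D i)) = 0 := by linarith
    rcases mul_eq_zero.1 this with h | h
    · exact h
    · linarith
  have h6 : ∀ i, u i = 0 := fun i => by rw [hu' i, h5]; simp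
  simp [h6] at hu


lemma mp_one {J : Type} [Fintype J] (a x : J → ℝ) (ha : ∀ j, 0 ≤ a j) (K : ℝ) (hK : 0 < K)
    (hx0 : ∀ j, 0 ≤ x j) (hxK : ∀ j, x j < K) (hβ : ∑ j, a j / (K - x j) ≤ 1 / 2)
    (y : ℝ) (hy : 0 ≤ y) (hyK : y / K < 1 / 2) :
    ∃ (θ w : Option J → ℝ), (∀ k, 0 ≤ θ k) ∧ (∀ k, θ k < K) ∧ (∀ k, 0 ≤ w k) ∧ (∑ k, w k = 1) ∧
      ∀ z : ℂ, z ≠ 0 → (∀ j, (x j : ℂ) - z ≠ 0) → (∀ k, (θ k : ℂ) - z ≠ 0) →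
        (∑ k, (w k : ℂ) / (θ k - z)) * (y - z * (1 + ∑ j, (a j : ℂ) / (x j - z))) =
          1 + ∑ j, (a j : ℂ) / (x j - z) := by
  classical
  set D : Option J → ℝ := fun i => i.elim 0 x with hD
  set v : Option J → ℝ := fun i => i.elim (√y) (fun j => √(a j)) with hv
  have hD0 : ∀ i, 0 ≤ D i := by
    intro i; cases i
    · simp [hD]
    · simpa [hD] using hx0 _
  have hDK : ∀ i, D i < K := by
    intro i; cases i
    · simpa [hD] using hK
    · simpa [hD] using hxK _
  obtain ⟨θ, u, h0, ho, hn, he⟩ := mp_spectral D v hD0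
  refine ⟨θ, fun k => u k none * u k none, h0, ?_, fun k => mul_self_nonneg _, ?_, ?_⟩
  · intro k
    refine mp_eig_lt D v K hDK ?_ (θ k) (u k) (hn k) (he k)
    rw [Fintype.sum_option]
    have h1 : ∀ j, v (some j) ^ 2 / (K - D (some j)) = a j / (K - x j) := by
      intro j; simp [hv, hD, Real.sq_sqrt (ha j)]
    have h2 : v none ^ 2 / (K - D none) = y / K := by
      simp [hv, hD, Real.sq_sqrt hy]
    simp only [h1, h2]
    linarith
  · simpa using ho none none
  · intro z hz hxz hθz
    have hz' : ∀ i, (D i : ℂ) - z ≠ 0 := by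
      intro i; cases i
      · simpa [hD] using hz
      · simpa [hD] using hxz _
    have := mp_resolvent D v rfl θ u ho he z hz' hθz
    have h1 : ∀ j, (v (some j) : ℂ) ^ 2 / (D (some j) - z) = a j / (x j - z) := by
      intro j
      have : (v (some j) : ℂ) ^ 2 = a j := by
        rw [← Complex.ofReal_pow]; simp [hv, Real.sq_sqrt (ha j)]
      rw [this]
      rfl
    have h2 : (v none : ℂ) ^ 2 = y := by
      rw [← Complex.ofReal_pow]; simp [hv, Real.sq_sqrt hy]
    simp only [h1, h2] at this
    push_cast
    exact this

/-- A finitely supported probability measure on pairs (mark, position). -/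
structure MPDat (c R K : ℝ) where
  J : Type
  fin : Fintype J
  p : J → ℝ
  l : J → ℝ
  x : J → ℝ
  p0 : ∀ j, 0 ≤ p j
  p1 : ∑ j, p j = 1
  l0 : ∀ j, 0 ≤ l j
  lR : ∀ j, l j ≤ R
  x0 : ∀ j, 0 ≤ x j
  xK : ∀ j, x j < K
  hβ : ∑ j, c * p j * l j / (K - x j) ≤ 1 / 2

attribute [instance] MPDat.fin

noncomputable def MPDat.h {c R K : ℝ} (d : MPDat c R K) (z : ℂ) : ℂ :=
  ∑ j, ((c * d.p j * d.l j : ℝ) : ℂ) / (d.x j - z)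

noncomputable def MPDat.m {c R K : ℝ} (d : MPDat c R K) (z : ℂ) : ℂ :=
  ∑ j, (d.p j : ℂ) / (d.x j - z)

lemma mp_ne {x : ℝ} {z : ℂ} (hz : 0 < z.im) : (x : ℂ) - z ≠ 0 := by
  intro h
  have := congrArg Complex.im h
  simp at this
  linarith

lemma mp_one_add_ne {h : ℂ} {z : ℂ} {y : ℝ} {g : ℂ} (hg : g * (y - z * (1 + h)) = 1 + h) (hne : 1 + h ≠ 0) :
    g = ((y : ℂ) * (1 + h)⁻¹ - z)⁻¹ := by
  apply eq_inv_of_mul_eq_one_left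
  field_simp
  linear_combination hg

lemma mp_step {c R K : ℝ} (hc : 0 < c) (hR : 0 < R) (hK : K = 2 * R + 2 * c * R)
    (d : MPDat c R K) (S : Finset ℝ) (q : ℝ → ℝ) (hq : ∀ y, 0 ≤ q y) (hq1 : ∑ y ∈ S, q y = 1)
    (hS : ∀ y ∈ S, 0 ≤ y ∧ y ≤ R) :
    ∃ d' : MPDat c R K, ∀ z : ℂ, 0 < z.im → 1 + d.h z ≠ 0 →
      d'.h z = ∑ y ∈ S, (q y : ℂ) * (c * y * ((y : ℂ) * (1 + d.h z)⁻¹ - z)⁻¹) ∧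
      d'.m z = ∑ y ∈ S, (q y : ℂ) * ((y : ℂ) * (1 + d.h z)⁻¹ - z)⁻¹ := by
  have hKpos : 0 < K := by rw [hK]; positivity
  have h2R : 2 * R < K := by rw [hK]; nlinarith [mul_pos hc hR]
  have ha : ∀ j, 0 ≤ c * d.p j * d.l j := fun j =>
    mul_nonneg (mul_nonneg hc.le (d.p0 j)) (d.l0 j)
  have H1 := fun y : S => mp_one (fun j => c * d.p j * d.l j) d.x ha K hKpos d.x0 d.xK d.hβ
    (y : ℝ) (hS y y.2).1 (by rw [div_lt_iff₀ hKpos]; linarith [(hS y y.2).2])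
  choose θ w hθ0 hθK hw0 hw1 hres using H1
  -- evaluation at K
  set β := ∑ j, c * d.p j * d.l j / (K - d.x j) with hβdef
  have hβ : β ≤ 1 / 2 := d.hβ
  have hKe : ∀ y : S, ∑ k, w y k / (K - θ y k) ≤ 1 / (K - 2 * R) := by
    intro y
    have := hres y (K : ℂ) (by exact_mod_cast hKpos.ne')
      (fun j => by exact_mod_cast (sub_neg.2 (d.xK j)).ne)
      (fun k => by exact_mod_cast (sub_neg.2 (hθK y k)).ne)
    norm_cast at this
    have e1 : ∑ k, w y k / (θ y k - K) = - ∑ k, w y k / (K - θ y k) := by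
      rw [← Finset.sum_neg_distrib]
      refine Finset.sum_congr rfl fun k _ => ?_
      rw [← div_neg, neg_sub]
    have e2 : ∑ j, c * d.p j * d.l j / (d.x j - K) = - β := by
      rw [hβdef, ← Finset.sum_neg_distrib]
      refine Finset.sum_congr rfl fun k _ => ?_
      rw [← div_neg, neg_sub]
    rw [e1, e2] at this
    set G := ∑ k, w y k / (K - θ y k)
    have hy := hS y y.2
    rw [le_div_iff₀ (by linarith)]
    have hG0 : 0 ≤ G := Finset.sum_nonneg fun k _ =>
      div_nonneg (hw0 y k) (by linarith [hθK y k])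
    have hb : 1 / 2 ≤ 1 - β := by linarith
    have h3 : G * (K * (1 - β) - y) = 1 - β := by linarith
    have h4 : (1 - β) * (K - 2 * R) ≤ K * (1 - β) - y := by nlinarith
    have h5 : G * ((1 - β) * (K - 2 * R)) ≤ 1 - β := by
      exact (mul_le_mul_of_nonneg_left h4 hG0).trans h3.le
    have h6 : (1 - β) * (G * (K - 2 * R)) ≤ (1 - β) * 1 := by linarith
    exact le_of_mul_le_mul_left h6 (by linarith)
  have hq1' : ∑ y : S, q y = 1 := by rw [← hq1, Finset.sum_coe_sort S q]
  refine ⟨⟨S × Option d.J, inferInstance, fun j => q j.1 * w j.1 j.2, fun j => j.1,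
    fun j => θ j.1 j.2, fun j => mul_nonneg (hq _) (hw0 _ _), ?_, fun j => (hS j.1 j.1.2).1,
    fun j => (hS j.1 j.1.2).2, fun j => hθ0 _ _, fun j => hθK _ _, ?_⟩, ?_⟩
  · rw [Fintype.sum_prod_type]
    simp only [← Finset.mul_sum, hw1, mul_one, hq1']
  · rw [Fintype.sum_prod_type]
    have : ∀ y : S, ∑ k, c * (q y * w y k) * y / (K - θ y k) ≤ q y * (1 / 2) := by
      intro y
      have hy := hS y y.2
      have e : ∑ k, c * (q y * w y k) * y / (K - θ y k)
          = q y * (c * y * ∑ k, w y k / (K - θ y k)) := by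
        rw [Finset.mul_sum, Finset.mul_sum]
        refine Finset.sum_congr rfl fun k _ => ?_
        ring
      rw [e]
      refine mul_le_mul_of_nonneg_left ?_ (hq y)
      calc c * y * ∑ k, w y k / (K - θ y k) ≤ c * y * (1 / (K - 2 * R)) :=
            mul_le_mul_of_nonneg_left (hKe y) (mul_nonneg hc.le hy.1)
        _ ≤ 1 / 2 := by
            have : K - 2 * R = 2 * (c * R) := by rw [hK]; ring
            rw [this, mul_one_div, div_le_div_iff₀ (by positivity) (by norm_num)]
            nlinarith [mul_le_mul_of_nonneg_left hy.2 hc.le]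
    calc _ ≤ ∑ y : S, q y * (1 / 2) := Finset.sum_le_sum fun y _ => this y
      _ = 1 / 2 := by rw [← Finset.sum_mul, hq1', one_mul]
  · intro z hz hne
    have hG : ∀ y : S, ∑ k, (w y k : ℂ) / (θ y k - z) = ((y : ℂ) * (1 + d.h z)⁻¹ - z)⁻¹ := by
      intro y
      refine mp_one_add_ne ?_ hne
      exact hres y z (by rintro rfl; simp at hz) (fun j => mp_ne hz) (fun k => mp_ne hz)
    constructor
    · rw [MPDat.h]
      simp only
      rw [Fintype.sum_prod_type, ← Finset.sum_coe_sort S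
        (fun y => (q y : ℂ) * (c * y * ((y : ℂ) * (1 + d.h z)⁻¹ - z)⁻¹))]
      refine Finset.sum_congr rfl fun y _ => ?_
      rw [← hG, Finset.mul_sum, Finset.mul_sum]
      refine Finset.sum_congr rfl fun k _ => ?_
      push_cast; ring
    · rw [MPDat.m]
      simp only
      rw [Fintype.sum_prod_type, ← Finset.sum_coe_sort S
        (fun y => (q y : ℂ) * ((y : ℂ) * (1 + d.h z)⁻¹ - z)⁻¹)]
      refine Finset.sum_congr rfl fun y _ => ?_
      rw [← hG, Finset.mul_sum]
      refine Finset.sum_congr rfl fun k _ => ?_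
      push_cast; ring


open Filter Topology in
lemma mp_functional_zero (K T : ℝ) (L : C(Set.Icc (0:ℝ) K, ℂ) →L[ℂ] ℂ)
    (hL : ∀ (z : ℂ) (f : C(Set.Icc (0:ℝ) K, ℂ)), z.re = 0 → T ≤ z.im → 0 < z.im →
      (∀ x, f x = (((x : ℝ) : ℂ) - z)⁻¹) → L f = 0) : L = 0 := by
  let a : C(Set.Icc (0:ℝ) K, ℂ) := ⟨fun x => ((x : ℝ) : ℂ), by fun_prop⟩
  have hps := L.comp_hasFPowerSeriesOnBall (spectrum.hasFPowerSeriesOnBall_inverse_one_sub_smul ℂ a)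
  have hat := hps.hasFPowerSeriesAt
  have hinv : ∀ t : ℝ, T ≤ t → 0 < t →
      L (Ring.inverse (1 - ((t : ℂ) * Complex.I)⁻¹ • a)) = 0 := by
    intro t hT ht
    set z : ℂ := (t : ℂ) * Complex.I with hz
    have hzim : z.im = t := by simp [hz]
    have hz0 : z ≠ 0 := by
      intro h; rw [h] at hzim; simp at hzim; linarith
    have hne : ∀ x : Set.Icc (0:ℝ) K, (((x : ℝ) : ℂ) - z) ≠ 0 := fun x =>
      mp_ne (by rw [hzim]; exact ht)
    let r : C(Set.Icc (0:ℝ) K, ℂ) := ⟨fun x => (((x : ℝ) : ℂ) - z)⁻¹, by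
      refine Continuous.inv₀ (by fun_prop) hne⟩
    have h1 : (1 - z⁻¹ • a) * ((-z) • r) = 1 := by
      ext x
      have := hne x
      simp only [ContinuousMap.mul_apply, ContinuousMap.sub_apply, ContinuousMap.one_apply,
        ContinuousMap.smul_apply, smul_eq_mul, a, r, ContinuousMap.coe_mk]
      field_simp
      ring
    have h2 : Ring.inverse (1 - z⁻¹ • a) = (-z) • r := by
      have hu : IsUnit (1 - z⁻¹ • a) := IsUnit.of_mul_eq_one _ h1
      calc Ring.inverse (1 - z⁻¹ • a)
          = Ring.inverse (1 - z⁻¹ • a) * ((1 - z⁻¹ • a) * ((-z) • r)) := by rw [h1, mul_one]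
        _ = (-z) • r := Ring.inverse_mul_cancel_left _ _ hu
    rw [h2, map_smul, hL z r (by simp [hz]) (by rw [hzim]; exact hT) (by rw [hzim]; exact ht) (fun x => rfl)]
    simp
  have hfreq : ∃ᶠ s in 𝓝[≠] (0 : ℂ), (L ∘ fun z : ℂ => Ring.inverse (1 - z • a)) s = 0 := by
    have htend : Tendsto (fun t : ℝ => ((t : ℂ) * Complex.I)⁻¹) atTop (𝓝[≠] 0) := by
      rw [tendsto_nhdsWithin_iff]
      constructor
      · refine tendsto_inv₀_cobounded.comp ?_
        rw [← tendsto_norm_atTop_iff_cobounded]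
        simp only [norm_mul, Complex.norm_real, Complex.norm_I, mul_one]
        exact tendsto_norm_atTop_atTop
      · filter_upwards [eventually_gt_atTop 0] with t ht
        simp [ht.ne']
    refine htend.frequently ?_
    refine Eventually.frequently ?_
    filter_upwards [eventually_ge_atTop T, eventually_gt_atTop 0] with t h1 h2
    exact hinv t h1 h2
  have hev := (hat.analyticAt.frequently_zero_iff_eventually_zero).1 hfreq
  have hp0 := hat.locally_zero_iff.1 hev
  have hpow : ∀ n : ℕ, L (a ^ n) = 0 := by
    intro n
    have := congrArg (fun q => q n (fun _ => (1 : ℂ))) hp0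
    simpa [ContinuousLinearMap.compFormalMultilinearSeries] using this
  let ι : C(ℝ, ℂ) := ⟨fun x => (x : ℂ), Complex.continuous_ofReal⟩
  have hreal : ∀ ψ : C(Set.Icc (0:ℝ) K, ℝ), L (ι.comp ψ) = 0 := by
    intro ψ
    have hcl : IsClosed {ψ : C(Set.Icc (0:ℝ) K, ℝ) | L (ι.comp ψ) = 0} :=
      isClosed_eq (L.continuous.comp (ContinuousMap.continuous_postcomp ι)) continuous_const
    have hsub : (polynomialFunctions (Set.Icc (0:ℝ) K) : Set C(Set.Icc (0:ℝ) K, ℝ)) ⊆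
        {ψ : C(Set.Icc (0:ℝ) K, ℝ) | L (ι.comp ψ) = 0} := by
      rw [polynomialFunctions_coe]
      rintro _ ⟨p, rfl⟩
      have : ι.comp (p.toContinuousMapOnAlgHom (Set.Icc (0:ℝ) K)) =
          ∑ i ∈ Finset.range (p.natDegree + 1), (p.coeff i : ℂ) • a ^ i := by
        ext x
        simp [ι, a, Polynomial.eval_eq_sum_range, ContinuousMap.sum_apply]
      simp only [Set.mem_ofPred_eq, this, map_sum, map_smul, hpow, smul_zero,
        Finset.sum_const_zero]
    have hmem := continuousMap_mem_polynomialFunctions_closure 0 K ψ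
    exact closure_minimal hsub hcl hmem
  ext φ
  let re : C(ℂ, ℝ) := ⟨Complex.re, Complex.continuous_re⟩
  let im : C(ℂ, ℝ) := ⟨Complex.im, Complex.continuous_im⟩
  have : φ = ι.comp (re.comp φ) + Complex.I • ι.comp (im.comp φ) := by
    ext x
    simp [ι, re, im, mul_comm Complex.I, Complex.re_add_im]
  rw [this, map_add, map_smul, hreal, hreal]
  simp

lemma mp_clm {Ω : Type*} [MeasurableSpace Ω] (ρ : Measure Ω) (f : Ω → ℂ)
    (hf : Integrable f ρ) (K : ℝ) (g : Ω → Set.Icc (0:ℝ) K) (hg : Measurable g) :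
    ∃ L : C(Set.Icc (0:ℝ) K, ℂ) →L[ℂ] ℂ, ∀ φ, L φ = ∫ ω, f ω * φ (g ω) ∂ρ := by
  have hint : ∀ φ : C(Set.Icc (0:ℝ) K, ℂ), Integrable (fun ω => f ω * φ (g ω)) ρ := by
    intro φ
    refine hf.mul_bdd (c := ‖φ‖) (φ.continuous.measurable.comp hg).aestronglyMeasurable ?_
    exact Filter.Eventually.of_forall fun ω => φ.norm_coe_le_norm _
  refine ⟨LinearMap.mkContinuous
    { toFun := fun φ => ∫ ω, f ω * φ (g ω) ∂ρ
      map_add' := ?_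
      map_smul' := ?_ } (∫ ω, ‖f ω‖ ∂ρ) ?_, fun φ => rfl⟩
  · intro φ ψ
    rw [← integral_add (hint φ) (hint ψ)]
    simp [mul_add]
  · intro r φ
    simp only [RingHom.id_apply, smul_eq_mul]
    rw [← integral_const_mul]
    congr 1; ext ω; simp; ring
  · intro φ
    simp only [LinearMap.coe_mk, AddHom.coe_mk]
    rw [← integral_mul_const]
    refine norm_integral_le_of_norm_le (hf.norm.mul_const _) ?_
    refine Filter.Eventually.of_forall fun ω => ?_
    rw [norm_mul]
    exact mul_le_mul_of_nonneg_left (φ.norm_coe_le_norm _) (norm_nonneg _)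

/-- Uniqueness for Stieltjes-type integrals that agree high up in the half plane. -/
lemma mp_unique_fun {Ω Ω' : Type*} [MeasurableSpace Ω] [MeasurableSpace Ω']
    (ρ : Measure Ω) (ρ' : Measure Ω') (f : Ω → ℂ) (f' : Ω' → ℂ)
    (hf : Integrable f ρ) (hf' : Integrable f' ρ') (K T : ℝ)
    (g : Ω → Set.Icc (0:ℝ) K) (hg : Measurable g) (g' : Ω' → Set.Icc (0:ℝ) K) (hg' : Measurable g')
    (h : ∀ z : ℂ, z.re = 0 → T ≤ z.im → 0 < z.im → ∫ ω, f ω * (((g ω : ℝ) : ℂ) - z)⁻¹ ∂ρ =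
      ∫ ω, f' ω * (((g' ω : ℝ) : ℂ) - z)⁻¹ ∂ρ') (φ : C(Set.Icc (0:ℝ) K, ℂ)) :
    ∫ ω, f ω * φ (g ω) ∂ρ = ∫ ω, f' ω * φ (g' ω) ∂ρ' := by
  obtain ⟨L, hL⟩ := mp_clm ρ f hf K g hg
  obtain ⟨L', hL'⟩ := mp_clm ρ' f' hf' K g' hg'
  have h0 : L - L' = 0 := by
    refine mp_functional_zero K T _ ?_
    intro z r hre hT hz hr
    rw [sub_apply, hL, hL']
    simp only [hr]
    rw [h z hre hT hz, sub_self]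
  have h1 : (L - L') φ = 0 := by rw [h0]; rfl
  rw [sub_apply] at h1
  rw [← hL, ← hL']
  exact sub_eq_zero.1 h1


/-- Bound for the denominators. -/
lemma mp_den {w z : ℂ} {y : ℝ} (hw : w.im ≤ 0) (hy : 0 ≤ y) :
    z.im ≤ ‖(y : ℂ) * w - z‖ := by
  have h1 : ((y : ℂ) * w - z).im ≤ -z.im := by
    rw [Complex.sub_im, Complex.im_ofReal_mul]
    nlinarith [mul_nonneg hy (neg_nonneg.2 hw)]
  have h2 := Complex.abs_im_le_norm ((y : ℂ) * w - z)
  have h3 := neg_abs_le ((y : ℂ) * w - z).im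
  linarith

lemma mp_den_ne {w z : ℂ} {y : ℝ} (hz : 0 < z.im) (hw : w.im ≤ 0) (hy : 0 ≤ y) :
    (y : ℂ) * w - z ≠ 0 := by
  have := mp_den (z := z) hw hy
  exact norm_pos_iff.1 (hz.trans_le this)

lemma mp_inv_bound {w z : ℂ} {y : ℝ} (hz : 0 < z.im) (hw : w.im ≤ 0) (hy : 0 ≤ y) :
    ‖((y : ℂ) * w - z)⁻¹‖ ≤ z.im⁻¹ := by
  rw [norm_inv]
  exact inv_anti₀ hz (mp_den hw hy)

lemma mp_inv_bound' {z : ℂ} (x : ℝ) (hz : 0 < z.im) : ‖((x : ℂ) - z)⁻¹‖ ≤ z.im⁻¹ := by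
  rw [norm_inv]
  refine inv_anti₀ hz ?_
  have h2 := Complex.abs_im_le_norm ((x : ℂ) - z)
  have h3 := neg_abs_le ((x : ℂ) - z).im
  simp at h2 h3
  linarith [le_abs_self z.im]

/-- difference in `w`. -/
lemma mp_diff_w {w₁ w₂ z : ℂ} {y R : ℝ} (hz : 0 < z.im) (hw₁ : w₁.im ≤ 0) (hw₂ : w₂.im ≤ 0)
    (hy : 0 ≤ y) (hyR : y ≤ R) :
    ‖((y : ℂ) * w₁ - z)⁻¹ - ((y : ℂ) * w₂ - z)⁻¹‖ ≤ R * (z.im⁻¹) ^ 2 * ‖w₁ - w₂‖ := by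
  have e : ((y : ℂ) * w₁ - z)⁻¹ - ((y : ℂ) * w₂ - z)⁻¹ =
      -(((y : ℂ) * w₁ - z)⁻¹ * ((y : ℂ) * w₂ - z)⁻¹ * (y * (w₁ - w₂))) := by
    have h1 := mp_den_ne hz hw₁ hy
    have h2 := mp_den_ne hz hw₂ hy
    field_simp
    ring
  rw [e, norm_neg, norm_mul, norm_mul, norm_mul, Complex.norm_real, Real.norm_of_nonneg hy]
  have b1 := mp_inv_bound hz hw₁ hy
  have b2 := mp_inv_bound hz hw₂ hy
  have hzi : 0 ≤ z.im⁻¹ := (inv_pos.2 hz).le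
  calc _ ≤ (z.im⁻¹ * z.im⁻¹) * (R * ‖w₁ - w₂‖) := by gcongr
    _ = _ := by ring

/-- difference in `y`. -/
lemma mp_diff_y {w z : ℂ} {y y' : ℝ} (hz : 0 < z.im) (hw : w.im ≤ 0)
    (hy : 0 ≤ y) (hy' : 0 ≤ y') :
    ‖(y : ℂ) * ((y : ℂ) * w - z)⁻¹ - (y' : ℂ) * ((y' : ℂ) * w - z)⁻¹‖ ≤
      ‖z‖ * (z.im⁻¹) ^ 2 * |y - y'| := by
  have e : (y : ℂ) * ((y : ℂ) * w - z)⁻¹ - (y' : ℂ) * ((y' : ℂ) * w - z)⁻¹ =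
      ((y : ℂ) * w - z)⁻¹ * ((y' : ℂ) * w - z)⁻¹ * (-z * ((y - y' : ℝ) : ℂ)) := by
    have h1 := mp_den_ne hz hw hy
    have h2 := mp_den_ne hz hw hy'
    have h3 : -z * ((y - y' : ℝ) : ℂ) = y * ((y' : ℂ) * w - z) - y' * ((y : ℂ) * w - z) := by
      push_cast; ring
    rw [h3]
    generalize (y : ℂ) * w - z = p at *
    generalize (y' : ℂ) * w - z = q at *
    field_simp
  rw [e, norm_mul, norm_mul, norm_mul, Complex.norm_real, norm_neg, Real.norm_eq_abs]
  have b1 := mp_inv_bound hz hw hy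
  have b2 := mp_inv_bound hz hw hy'
  have hzi : 0 ≤ z.im⁻¹ := (inv_pos.2 hz).le
  calc _ ≤ (z.im⁻¹ * z.im⁻¹) * (‖z‖ * |y - y'|) := by gcongr
    _ = _ := by ring

lemma mp_ae {H : Measure ℝ} [IsProbabilityMeasure H] {R : ℝ} (h : H (Set.Icc 0 R) = 1) :
    ∀ᵐ x ∂H, x ∈ Set.Icc 0 R := by
  rw [ae_iff_prob_eq_one]
  · exact h
  · exact (measurableSet_Icc).mem

lemma mp_R_nonneg {H : Measure ℝ} {R : ℝ} (h : H (Set.Icc 0 R) = 1) : 0 ≤ R := by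
  by_contra hR
  rw [Set.Icc_eq_empty hR] at h
  simp at h

lemma mp_int_inv {Ω : Type*} [MeasurableSpace Ω] (ν : Measure Ω) [IsFiniteMeasure ν]
    (g : Ω → ℝ) (hg : Measurable g) {z : ℂ}
    (hz : 0 < z.im) : Integrable (fun x => ((g x : ℂ) - z)⁻¹) ν := by
  refine Integrable.of_bound (C := z.im⁻¹) ?_ (Filter.Eventually.of_forall fun x => mp_inv_bound' _ hz)
  exact ((Complex.measurable_ofReal.comp hg).sub_const z).inv.aestronglyMeasurable

lemma mp_im_integral {Ω : Type*} [MeasurableSpace Ω] {ν : Measure Ω} {f : Ω → ℂ}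
    (hf : Integrable f ν) : (∫ x, f x ∂ν).im = ∫ x, (f x).im ∂ν :=
  (integral_im hf).symm

/-- the term `1 - c - c z m` lies in the closed lower half plane. -/
lemma mp_w_im {c : ℝ} (hc : 0 < c) (ν : Measure ℝ) [IsProbabilityMeasure ν] {R : ℝ}
    (h : ν (Set.Icc 0 R) = 1) {z : ℂ} (hz : 0 < z.im) :
    (1 - (c : ℂ) - (c : ℂ) * z * stieltjesTransform ν z).im ≤ 0 := by
  have h1 : 0 ≤ (z * stieltjesTransform ν z).im := by
    have hI : Integrable (fun x : ℝ => z * ((x : ℂ) - z)⁻¹) ν :=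
      (mp_int_inv ν id measurable_id hz).const_mul z
    rw [stieltjesTransform, ← integral_const_mul, mp_im_integral hI]
    refine integral_nonneg_of_ae ?_
    filter_upwards [mp_ae h] with x hx
    have e : z * ((x : ℂ) - z)⁻¹ = -1 + x * ((x : ℂ) - z)⁻¹ := by
      have := mp_ne (x := x) hz
      field_simp
      ring
    simp only [Pi.zero_apply]
    rw [e, Complex.add_im, Complex.im_ofReal_mul, Complex.inv_im]
    have : 0 ≤ -((x : ℂ) - z).im / Complex.normSq ((x : ℂ) - z) := by
      apply div_nonneg _ (Complex.normSq_nonneg _)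
      simp [hz.le]
    simpa using mul_nonneg hx.1 this
  rw [mul_assoc, Complex.sub_im, Complex.im_ofReal_mul]
  simp
  positivity

lemma mp_unique_measure (ν₁ ν₂ : Measure ℝ) [IsProbabilityMeasure ν₁] [IsProbabilityMeasure ν₂]
    {R₁ R₂ : ℝ} (h₁ : ν₁ (Set.Icc 0 R₁) = 1) (h₂ : ν₂ (Set.Icc 0 R₂) = 1) (T : ℝ)
    (h : ∀ z : ℂ, z.re = 0 → T ≤ z.im → 0 < z.im →
      stieltjesTransform ν₁ z = stieltjesTransform ν₂ z) : ν₁ = ν₂ := by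
  set K := max R₁ R₂ with hK
  have hK0 : (0:ℝ) ≤ K := (mp_R_nonneg h₁).trans (le_max_left _ _)
  have a₁ : ∀ᵐ x ∂ν₁, x ∈ Set.Icc 0 K := by
    filter_upwards [mp_ae h₁] with x hx using ⟨hx.1, hx.2.trans (le_max_left _ _)⟩
  have a₂ : ∀ᵐ x ∂ν₂, x ∈ Set.Icc 0 K := by
    filter_upwards [mp_ae h₂] with x hx using ⟨hx.1, hx.2.trans (le_max_right _ _)⟩
  have hm : Measurable (Set.projIcc 0 K hK0) := continuous_projIcc.measurable
  have gen : ∀ (ν : Measure ℝ), (∀ᵐ x ∂ν, x ∈ Set.Icc 0 K) → ∀ F : ℝ → ℂ,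
      ∫ x, (1:ℂ) * F (Set.projIcc 0 K hK0 x) ∂ν = ∫ x, F x ∂ν := by
    intro ν hν F
    refine integral_congr_ae ?_
    filter_upwards [hν] with x hx
    rw [Set.projIcc_of_mem hK0 hx, one_mul]
  have key := mp_unique_fun ν₁ ν₂ (fun _ => 1) (fun _ => 1) (integrable_const _) (integrable_const _)
    K T (Set.projIcc 0 K hK0) hm (Set.projIcc 0 K hK0) hm (by
      intro z hre hT hz
      rw [gen ν₁ a₁ (fun x => ((x : ℂ) - z)⁻¹), gen ν₂ a₂ (fun x => ((x : ℂ) - z)⁻¹)]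
      exact h z hre hT hz)
  refine ext_of_forall_integral_eq_of_IsFiniteMeasure fun f => ?_
  have := key ⟨fun x => ((f x : ℝ) : ℂ), by fun_prop⟩
  simp only [ContinuousMap.coe_mk] at this
  rw [gen ν₁ a₁ (fun x => ((f x : ℝ) : ℂ)), gen ν₂ a₂ (fun x => ((f x : ℝ) : ℂ)),
    integral_complex_ofReal, integral_complex_ofReal] at this
  exact_mod_cast this

lemma mp_uniqueness (c : ℝ) (hc : 0 < c) (H : Measure ℝ) [IsProbabilityMeasure H] {R : ℝ}
    (hH : H (Set.Icc 0 R) = 1) (ν₁ ν₂ : Measure ℝ) [IsProbabilityMeasure ν₁]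
    [IsProbabilityMeasure ν₂]
    {R₁ R₂ : ℝ} (h₁ : ν₁ (Set.Icc 0 R₁) = 1) (h₂ : ν₂ (Set.Icc 0 R₂) = 1)
    (e₁ : ∀ z : ℂ, 0 < z.im → stieltjesTransform ν₁ z =
      ∫ x, ((x : ℂ) * (1 - (c : ℂ) - (c : ℂ) * z * stieltjesTransform ν₁ z) - z)⁻¹ ∂H)
    (e₂ : ∀ z : ℂ, 0 < z.im → stieltjesTransform ν₂ z =
      ∫ x, ((x : ℂ) * (1 - (c : ℂ) - (c : ℂ) * z * stieltjesTransform ν₂ z) - z)⁻¹ ∂H) :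
    ν₁ = ν₂ := by
  have hR := mp_R_nonneg hH
  refine mp_unique_measure ν₁ ν₂ h₁ h₂ (R * c + 1) ?_
  intro z hre hT hz
  have E₁ := e₁ z hz
  have E₂ := e₂ z hz
  have w₁ := mp_w_im hc ν₁ h₁ hz
  have w₂ := mp_w_im hc ν₂ h₂ hz
  set m₁ := stieltjesTransform ν₁ z
  set m₂ := stieltjesTransform ν₂ z
  have hnz : ‖z‖ = z.im := by
    have : z = z.im * Complex.I := by
      apply Complex.ext <;> simp [hre]
    rw [this]
    simp [hz.le]
  have hI : ∀ w : ℂ, w.im ≤ 0 → Integrable (fun x : ℝ => ((x : ℂ) * w - z)⁻¹) H := by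
    intro w hw
    refine Integrable.of_bound (C := z.im⁻¹) ?_ ?_
    · exact ((Complex.measurable_ofReal.mul_const w).sub_const z).inv.aestronglyMeasurable
    · filter_upwards [mp_ae hH] with x hx using mp_inv_bound hz hw hx.1
  have b : ‖m₁ - m₂‖ ≤ R * (z.im⁻¹) ^ 2 * (c * z.im * ‖m₁ - m₂‖) := by
    conv_lhs => rw [E₁, E₂]
    rw [← integral_sub (hI _ w₁) (hI _ w₂)]
    refine (norm_integral_le_of_norm_le_const (C := R * (z.im⁻¹) ^ 2 * (c * z.im * ‖m₁ - m₂‖)) ?_).trans ?_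
    · filter_upwards [mp_ae hH] with x hx
      refine (mp_diff_w hz w₁ w₂ hx.1 hx.2).trans_eq ?_
      congr 1
      have : (1 - (c : ℂ) - c * z * m₁) - (1 - (c : ℂ) - c * z * m₂) = -(c * z * (m₁ - m₂)) := by
        ring
      rw [this, norm_neg, norm_mul, norm_mul, hnz, Complex.norm_real, Real.norm_of_nonneg hc.le]
    · simp
  by_contra hne
  have hpos : 0 < ‖m₁ - m₂‖ := norm_pos_iff.2 (sub_ne_zero.2 hne)
  have e : R * (z.im⁻¹) ^ 2 * (c * z.im * ‖m₁ - m₂‖) = (R * c / z.im) * ‖m₁ - m₂‖ := by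
    field_simp
  rw [e] at b
  have : R * c / z.im < 1 := by rw [div_lt_one hz]; linarith
  nlinarith


noncomputable def mpH (c : ℝ) {R K : ℝ} (ρ : Measure (Set.Icc (0:ℝ) R × Set.Icc (0:ℝ) K)) (z : ℂ) : ℂ :=
  ∫ ω, ((c * (ω.1 : ℝ) : ℝ) : ℂ) * (((ω.2 : ℝ) : ℂ) - z)⁻¹ ∂ρ

noncomputable def mpM {R K : ℝ} (ρ : Measure (Set.Icc (0:ℝ) R × Set.Icc (0:ℝ) K)) (z : ℂ) : ℂ :=
  ∫ ω, (((ω.2 : ℝ) : ℂ) - z)⁻¹ ∂ρ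

lemma mp_cont_inv {R K : ℝ} {z : ℂ} (hz : 0 < z.im) :
    Continuous (fun ω : Set.Icc (0:ℝ) R × Set.Icc (0:ℝ) K => (((ω.2 : ℝ) : ℂ) - z)⁻¹) :=
  Continuous.inv₀ (by fun_prop) (fun _ => mp_ne hz)

lemma mp_cont_h (c : ℝ) {R K : ℝ} {z : ℂ} (hz : 0 < z.im) :
    Continuous (fun ω : Set.Icc (0:ℝ) R × Set.Icc (0:ℝ) K =>
      ((c * (ω.1 : ℝ) : ℝ) : ℂ) * (((ω.2 : ℝ) : ℂ) - z)⁻¹) :=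
  Continuous.mul (by fun_prop) (mp_cont_inv hz)

lemma mp_int_cont {X : Type*} [TopologicalSpace X] [CompactSpace X] [MeasurableSpace X]
    [OpensMeasurableSpace X] (ρ : Measure X) [IsFiniteMeasure ρ] {f : X → ℂ} (hf : Continuous f) :
    Integrable f ρ := by
  refine Integrable.of_bound (C := ‖(⟨f, hf⟩ : C(X, ℂ))‖) hf.measurable.aestronglyMeasurable ?_
  exact Filter.Eventually.of_forall fun x => (⟨f, hf⟩ : C(X, ℂ)).norm_coe_le_norm x

lemma mpH_im {c R K : ℝ} (hc : 0 < c) (ρ : Measure (Set.Icc (0:ℝ) R × Set.Icc (0:ℝ) K))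
    [IsProbabilityMeasure ρ] {z : ℂ} (hz : 0 < z.im) : 0 ≤ (mpH c ρ z).im := by
  rw [mpH, mp_im_integral (mp_int_cont ρ (mp_cont_h c hz))]
  refine integral_nonneg fun ω => ?_
  simp only [Pi.zero_apply]
  rw [Complex.im_ofReal_mul, Complex.inv_im]
  refine mul_nonneg (mul_nonneg hc.le ω.1.2.1) ?_
  apply div_nonneg _ (Complex.normSq_nonneg _)
  simp [hz.le]

lemma mpH_zim {c R K : ℝ} (hc : 0 < c) (ρ : Measure (Set.Icc (0:ℝ) R × Set.Icc (0:ℝ) K))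
    [IsProbabilityMeasure ρ] {z : ℂ} (hz : 0 < z.im) : 0 ≤ (z * mpH c ρ z).im := by
  rw [mpH, ← integral_const_mul, mp_im_integral ((mp_int_cont ρ (mp_cont_h c hz)).const_mul z)]
  refine integral_nonneg fun ω => ?_
  simp only [Pi.zero_apply]
  have e : z * (((c * (ω.1 : ℝ) : ℝ) : ℂ) * (((ω.2 : ℝ) : ℂ) - z)⁻¹) =
      ((c * (ω.1 : ℝ) : ℝ) : ℂ) * (-1 + (ω.2 : ℝ) * (((ω.2 : ℝ) : ℂ) - z)⁻¹) := by
    have := mp_ne (x := (ω.2 : ℝ)) hz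
    field_simp
    ring
  rw [e, Complex.im_ofReal_mul, Complex.add_im, Complex.im_ofReal_mul, Complex.inv_im]
  refine mul_nonneg (mul_nonneg hc.le ω.1.2.1) ?_
  have : 0 ≤ -(((ω.2 : ℝ) : ℂ) - z).im / Complex.normSq (((ω.2 : ℝ) : ℂ) - z) := by
    apply div_nonneg _ (Complex.normSq_nonneg _)
    simp [hz.le]
  simpa using mul_nonneg ω.2.2.1 this

lemma mpH_norm {c R K : ℝ} (hc : 0 < c) (ρ : Measure (Set.Icc (0:ℝ) R × Set.Icc (0:ℝ) K))
    [IsProbabilityMeasure ρ] {z : ℂ} (hz : 0 < z.im) : ‖mpH c ρ z‖ ≤ c * R * z.im⁻¹ := by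
  refine (norm_integral_le_of_norm_le_const (C := c * R * z.im⁻¹) ?_).trans (by simp)
  refine Filter.Eventually.of_forall fun ω => ?_
  rw [norm_mul, Complex.norm_real, Real.norm_of_nonneg (mul_nonneg hc.le ω.1.2.1)]
  have h1 := mp_inv_bound' (ω.2 : ℝ) hz
  have h2 : c * (ω.1 : ℝ) ≤ c * R := mul_le_mul_of_nonneg_left ω.1.2.2 hc.le
  exact mul_le_mul h2 h1 (norm_nonneg _) ((mul_nonneg hc.le ω.1.2.1).trans h2)

lemma mpH_ne {c R K : ℝ} (hc : 0 < c) (ρ : Measure (Set.Icc (0:ℝ) R × Set.Icc (0:ℝ) K))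
    [IsProbabilityMeasure ρ] {z : ℂ} (hz : 0 < z.im) : 1 + mpH c ρ z ≠ 0 := by
  intro h
  have h1 := mpH_zim hc ρ hz
  have : mpH c ρ z = -1 := by linear_combination h
  rw [this] at h1
  simp at h1
  linarith

lemma mpH_w {c R K : ℝ} (hc : 0 < c) (ρ : Measure (Set.Icc (0:ℝ) R × Set.Icc (0:ℝ) K))
    [IsProbabilityMeasure ρ] {z : ℂ} (hz : 0 < z.im) : ((1 + mpH c ρ z)⁻¹).im ≤ 0 := by
  have := mpH_im hc ρ hz
  rw [Complex.inv_im]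
  apply div_nonpos_of_nonpos_of_nonneg _ (Complex.normSq_nonneg _)
  simpa using this

lemma MPDat.exists_pm {c R K : ℝ} (d : MPDat c R K) :
    ∃ ρ : ProbabilityMeasure (Set.Icc (0:ℝ) R × Set.Icc (0:ℝ) K),
      (∀ z, mpH c ρ.toMeasure z = d.h z) ∧ (∀ z, mpM ρ.toMeasure z = d.m z) := by
  set pt : d.J → Set.Icc (0:ℝ) R × Set.Icc (0:ℝ) K := fun j =>
    (⟨d.l j, d.l0 j, d.lR j⟩, ⟨d.x j, d.x0 j, (d.xK j).le⟩) with hpt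
  set μ : Measure (Set.Icc (0:ℝ) R × Set.Icc (0:ℝ) K) :=
    ∑ j, ENNReal.ofReal (d.p j) • Measure.dirac (pt j) with hμ
  have hprob : IsProbabilityMeasure μ := by
    constructor
    rw [hμ, Measure.finsetSum_apply]
    simp only [Measure.smul_apply, measure_univ, smul_eq_mul, mul_one]
    rw [← ENNReal.ofReal_sum_of_nonneg (fun j _ => d.p0 j), d.p1, ENNReal.ofReal_one]
  have hint : ∀ f : Set.Icc (0:ℝ) R × Set.Icc (0:ℝ) K → ℂ,
      ∫ ω, f ω ∂μ = ∑ j, (d.p j : ℂ) * f (pt j) := by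
    intro f
    rw [hμ, integral_finsetSum_measure]
    · refine Finset.sum_congr rfl fun j _ => ?_
      rw [integral_smul_measure, integral_dirac, ENNReal.toReal_ofReal (d.p0 j)]
      simp
    · intro j _
      refine Integrable.smul_measure ?_ ENNReal.ofReal_ne_top
      exact integrable_dirac (by simp)
  refine ⟨⟨μ, hprob⟩, fun z => ?_, fun z => ?_⟩
  · change ∫ ω, _ ∂μ = _
    rw [hint, MPDat.h]
    refine Finset.sum_congr rfl fun j _ => ?_
    simp only [hpt]
    push_cast
    ring
  · change ∫ ω, _ ∂μ = _
    rw [hint, MPDat.m]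
    refine Finset.sum_congr rfl fun j _ => ?_
    simp only [hpt]
    ring

lemma mp_simple_integral (H : Measure ℝ) [IsProbabilityMeasure H] (s : SimpleFunc ℝ ℝ) (φ : ℝ → ℂ) :
    ∫ x, φ (s x) ∂H = ∑ y ∈ s.range, (H.real (s ⁻¹' {y}) : ℂ) * φ y := by
  have : ∀ x, φ (s x) = ∑ y ∈ s.range, (s ⁻¹' {y}).indicator (fun _ => φ y) x := by
    intro x
    rw [Finset.sum_eq_single (s x)]
    · simp
    · intro y _ hy
      simp [Set.indicator, hy.symm]
    · intro h
      exact absurd (s.mem_range_self x) h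
  simp only [this]
  rw [integral_finsetSum]
  · refine Finset.sum_congr rfl fun y _ => ?_
    rw [integral_indicator_const _ (s.measurableSet_fiber y)]
    simp
  · intro y _
    exact (integrable_const _).indicator (s.measurableSet_fiber y)

lemma mp_seq {c R : ℝ} (hc : 0 < c) (hR : 0 < R) (H : Measure ℝ) [IsProbabilityMeasure H]
    (s : ℕ → SimpleFunc ℝ ℝ) (hs : ∀ n x, s n x ∈ Set.Icc 0 R) :
    ∃ (K : ℝ) (ρ : ℕ → ProbabilityMeasure (Set.Icc (0:ℝ) R × Set.Icc (0:ℝ) K)),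
      ∀ n, ∀ z : ℂ, 0 < z.im →
        mpH c (ρ (n + 1)).toMeasure z = ∫ x, (c : ℂ) * ((s n x : ℝ) *
          (((s n x : ℝ) : ℂ) * (1 + mpH c (ρ n).toMeasure z)⁻¹ - z)⁻¹) ∂H ∧
        mpM (ρ (n + 1)).toMeasure z = ∫ x,
          (((s n x : ℝ) : ℂ) * (1 + mpH c (ρ n).toMeasure z)⁻¹ - z)⁻¹ ∂H := by
  set K := 2 * R + 2 * c * R with hK
  have hK0 : 0 < K := by positivity
  have hq1 : ∀ n, ∑ y ∈ (s n).range, H.real ((s n) ⁻¹' {y}) = 1 := by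
    intro n
    have := mp_simple_integral H (s n) (fun _ => 1)
    simp only [mul_one] at this
    rw [integral_const] at this
    simp at this
    exact_mod_cast this.symm
  have hS : ∀ n, ∀ y ∈ (s n).range, 0 ≤ y ∧ y ≤ R := by
    intro n y hy
    obtain ⟨x, rfl⟩ := SimpleFunc.mem_range.1 hy
    exact hs n x
  have hstep := fun n (d : MPDat c R K) => mp_step hc hR hK d (s n).range
    (fun y => H.real ((s n) ⁻¹' {y})) (fun y => measureReal_nonneg) (hq1 n) (hS n)
  choose F hF using hstep
  let d0 : MPDat c R K :=
    { J := Unit, fin := inferInstance, p := fun _ => 1, l := fun _ => 0, x := fun _ => 0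
      p0 := by simp
      p1 := by simp
      l0 := by simp
      lR := fun _ => hR.le
      x0 := by simp
      xK := fun _ => hK0
      hβ := by simp }
  let d : ℕ → MPDat c R K := fun n => Nat.rec d0 (fun n e => F n e) n
  have hd : ∀ n, d (n + 1) = F n (d n) := fun n => rfl
  choose P hPh hPm using fun e : MPDat c R K => e.exists_pm
  refine ⟨K, fun n => P (d n), fun n z hz => ?_⟩
  have hne := mpH_ne hc (P (d n)).toMeasure hz
  rw [hPh] at hne ⊢
  have := hF n (d n) z hz hne
  rw [hPm, hPh, hd, this.1, this.2]
  constructor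
  · rw [mp_simple_integral H (s n) (fun y : ℝ => (c : ℂ) * (y * ((y : ℂ) * (1 + (d n).h z)⁻¹ - z)⁻¹))]
    refine Finset.sum_congr rfl fun y _ => ?_
    ring
  · rw [mp_simple_integral H (s n) (fun y : ℝ => ((y : ℂ) * (1 + (d n).h z)⁻¹ - z)⁻¹)]


open Filter Topology in
lemma mp_real_seq (a ε : ℕ → ℝ) (ha : ∀ n, 0 ≤ a n) (h : ∀ n, a (n + 1) ≤ a n / 2 + ε n)
    (hε : Tendsto ε atTop (𝓝 0)) : Tendsto a atTop (𝓝 0) := by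
  rw [Metric.tendsto_atTop]
  intro δ hδ
  obtain ⟨N, hN⟩ := (Metric.tendsto_atTop.1 hε) (δ / 4) (by positivity)
  have hN' : ∀ n ≥ N, ε n ≤ δ / 4 := by
    intro n hn
    have := hN n hn
    rw [Real.dist_eq, sub_zero] at this
    exact (le_abs_self _).trans this.le
  have hind : ∀ k, a (N + k) ≤ a N * (1 / 2) ^ k + δ / 2 := by
    intro k
    induction k with
    | zero => simp; positivity
    | succ k ih =>
      have h1 := h (N + k)
      have h2 := hN' (N + k) (by omega)
      rw [← add_assoc, pow_succ]
      linarith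
  have hlim : Tendsto (fun k : ℕ => a N * (1 / 2 : ℝ) ^ k) atTop (𝓝 0) := by
    have := (tendsto_pow_atTop_nhds_zero_of_lt_one (r := (1 / 2 : ℝ)) (by norm_num)
      (by norm_num)).const_mul (a N)
    simpa using this
  obtain ⟨M, hM⟩ := (Metric.tendsto_atTop.1 hlim) (δ / 2) (by positivity)
  refine ⟨N + M, fun n hn => ?_⟩
  obtain ⟨k, rfl⟩ : ∃ k, n = N + k := ⟨n - N, by omega⟩
  have h1 := hM k (by omega)
  rw [Real.dist_eq, sub_zero] at h1
  have h2 := (le_abs_self _).trans_lt h1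
  rw [Real.dist_eq, sub_zero, abs_of_nonneg (ha _)]
  linarith [hind k]

open Filter Topology in
lemma mp_tendsto_h {R K : ℝ} {f : Set.Icc (0:ℝ) R × Set.Icc (0:ℝ) K → ℂ} (hf : Continuous f)
    {ρ : ℕ → ProbabilityMeasure (Set.Icc (0:ℝ) R × Set.Icc (0:ℝ) K)}
    {ρ' : ProbabilityMeasure (Set.Icc (0:ℝ) R × Set.Icc (0:ℝ) K)}
    (h : Tendsto ρ atTop (𝓝 ρ')) :
    Tendsto (fun n => ∫ ω, f ω ∂(ρ n).toMeasure) atTop (𝓝 (∫ ω, f ω ∂ρ'.toMeasure)) :=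
  (ProbabilityMeasure.tendsto_iff_forall_integral_rclike_tendsto ℂ).1 h
    (BoundedContinuousFunction.mkOfCompact ⟨f, hf⟩)

lemma mp_w_diff {h₁ h₂ : ℂ} (b₁ : ‖h₁‖ ≤ 1 / 2) (b₂ : ‖h₂‖ ≤ 1 / 2) :
    ‖(1 + h₁)⁻¹ - (1 + h₂)⁻¹‖ ≤ 4 * ‖h₁ - h₂‖ := by
  have low : ∀ h : ℂ, ‖h‖ ≤ 1 / 2 → 1 / 2 ≤ ‖1 + h‖ := by
    intro h hh
    have := norm_sub_norm_le (1 : ℂ) (-h)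
    rw [norm_neg, norm_one, sub_neg_eq_add] at this
    linarith
  have l₁ := low h₁ b₁
  have l₂ := low h₂ b₂
  have n₁ : 1 + h₁ ≠ 0 := norm_pos_iff.1 (by linarith)
  have n₂ : 1 + h₂ ≠ 0 := norm_pos_iff.1 (by linarith)
  have e : (1 + h₁)⁻¹ - (1 + h₂)⁻¹ = -((1 + h₁)⁻¹ * (1 + h₂)⁻¹ * (h₁ - h₂)) := by
    field_simp
    ring
  have i₁ : ‖1 + h₁‖⁻¹ ≤ 2 := by
    have := inv_anti₀ (by norm_num) l₁
    simpa using this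
  have i₂ : ‖1 + h₂‖⁻¹ ≤ 2 := by
    have := inv_anti₀ (by norm_num) l₂
    simpa using this
  rw [e, norm_neg, norm_mul, norm_mul, norm_inv, norm_inv]
  calc _ ≤ 2 * 2 * ‖h₁ - h₂‖ := by gcongr
    _ = _ := by ring

open Filter Topology in
lemma mp_existence (c : ℝ) (hc : 0 < c) (H : Measure ℝ) [IsProbabilityMeasure H] {R : ℝ}
    (hR : 0 < R) (hH : H (Set.Icc 0 R) = 1) :
    ∃ ν : Measure ℝ, IsProbabilityMeasure ν ∧ (∃ R : ℝ, ν (Set.Icc 0 R) = 1) ∧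
      ∀ z : ℂ, 0 < z.im → stieltjesTransform ν z =
        ∫ x, ((x : ℂ) * (1 - (c : ℂ) - (c : ℂ) * z * stieltjesTransform ν z) - z)⁻¹ ∂H := by
  have hmem : (0 : ℝ) ∈ Set.Icc (0:ℝ) R := ⟨le_rfl, hR.le⟩
  set s : ℕ → SimpleFunc ℝ ℝ := fun n =>
    SimpleFunc.approxOn id measurable_id (Set.Icc 0 R) 0 hmem n with hsdef
  have hs : ∀ n x, s n x ∈ Set.Icc 0 R := fun n x =>
    SimpleFunc.approxOn_mem measurable_id hmem n x
  have hslim : ∀ x ∈ Set.Icc 0 R, Tendsto (fun n => s n x) atTop (𝓝 x) := fun x hx =>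
    SimpleFunc.tendsto_approxOn measurable_id hmem (subset_closure hx)
  obtain ⟨K, ρ, hρ⟩ := mp_seq hc hR H s hs
  -- integrability
  have hI : ∀ (n : ℕ) (w z : ℂ), 0 < z.im → w.im ≤ 0 →
      Integrable (fun x => (((s n x : ℝ) : ℂ) * w - z)⁻¹) H := by
    intro n w z hz hw
    refine Integrable.of_bound (C := z.im⁻¹) ?_
      (Eventually.of_forall fun x => mp_inv_bound hz hw (hs n x).1)
    exact (((Complex.measurable_ofReal.comp (s n).measurable).mul_const w).sub_const
      z).inv.aestronglyMeasurable
  have hbd : ∀ (y : ℝ) (w z : ℂ), 0 < z.im → w.im ≤ 0 → y ∈ Set.Icc 0 R →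
      ‖(c : ℂ) * ((y : ℂ) * ((y : ℂ) * w - z)⁻¹)‖ ≤ c * (R * z.im⁻¹) := by
    intro y w z hz hw hy
    rw [norm_mul, norm_mul, Complex.norm_real, Complex.norm_real, Real.norm_of_nonneg hc.le,
      Real.norm_of_nonneg hy.1]
    have := mp_inv_bound hz hw hy.1
    have := hy.2
    gcongr
  have hIc : ∀ (n : ℕ) (w z : ℂ), 0 < z.im → w.im ≤ 0 →
      Integrable (fun x => (c : ℂ) * ((s n x : ℝ) * (((s n x : ℝ) : ℂ) * w - z)⁻¹)) H := by
    intro n w z hz hw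
    refine Integrable.of_bound (C := c * (R * z.im⁻¹)) ?_
      (Eventually.of_forall fun x => hbd _ w z hz hw (hs n x))
    have hm : Measurable fun x => ((s n x : ℝ) : ℂ) :=
      Complex.measurable_ofReal.comp (s n).measurable
    exact (measurable_const.mul (hm.mul ((hm.mul_const w).sub_const z).inv)).aestronglyMeasurable
  -- consecutive differences of the discretizations
  have hsdiff : Tendsto (fun n => ∫ x, |s (n + 1) x - s n x| ∂H) atTop (𝓝 0) := by
    have := tendsto_integral_of_dominated_convergence (μ := H)
      (F := fun n x => |s (n + 1) x - s n x|) (f := fun _ => (0 : ℝ)) (fun _ => R)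
      (fun n => ((s (n + 1)).measurable.sub (s n).measurable).abs.aestronglyMeasurable)
      (integrable_const _)
      (fun n => Eventually.of_forall fun x => by
        rw [Real.norm_eq_abs, abs_abs, abs_le]
        have h1 := hs (n + 1) x
        have h2 := hs n x
        constructor <;> linarith [h1.1, h1.2, h2.1, h2.2])
      (by
        filter_upwards [mp_ae hH] with x hx
        have h1 := hslim x hx
        have h2 := (h1.comp (tendsto_add_atTop_nat 1)).sub h1
        simpa using h2.abs)
    simpa using this
  set T : ℝ := 1 + 2 * (c * R) + 8 * (c * R ^ 2) with hT
  have hT0 : 0 < T := by positivity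
  have hdiff : ∀ z : ℂ, T ≤ z.im →
      Tendsto (fun n => ‖mpH c (ρ (n + 1)).toMeasure z - mpH c (ρ n).toMeasure z‖)
        atTop (𝓝 0) := by
    intro z hTz
    have hz : 0 < z.im := hT0.trans_le hTz
    have hv : 0 < z.im⁻¹ := inv_pos.2 hz
    have hsmall : ∀ n, ‖mpH c (ρ n).toMeasure z‖ ≤ 1 / 2 := by
      intro n
      refine (mpH_norm hc _ hz).trans ?_
      rw [← div_eq_mul_inv, div_le_iff₀ hz]
      have : 0 ≤ 8 * (c * R ^ 2) := by positivity
      linarith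
    have hcon : c * R ^ 2 * (z.im⁻¹) ^ 2 * 4 ≤ 1 / 2 := by
      have h1 : 8 * (c * R ^ 2) ≤ z.im ^ 2 := by
        have : 0 ≤ 2 * (c * R) := by positivity
        have h0 : 0 ≤ 8 * (c * R ^ 2) := by positivity
        have h1 : 1 ≤ z.im := by linarith
        nlinarith
      rw [inv_pow]
      have : c * R ^ 2 * (z.im ^ 2)⁻¹ * 4 = (4 * (c * R ^ 2)) / z.im ^ 2 := by ring
      rw [this, div_le_iff₀ (by positivity)]
      linarith
    refine mp_real_seq _ (fun n => c * (‖z‖ * (z.im⁻¹) ^ 2) * ∫ x, |s (n + 1) x - s n x| ∂H)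
      (fun n => norm_nonneg _) ?_ (by
        have := hsdiff.const_mul (c * (‖z‖ * (z.im⁻¹) ^ 2))
        rwa [mul_zero] at this)
    intro n
    have w₁ := mpH_w hc (ρ (n + 1)).toMeasure hz
    have w₀ := mpH_w hc (ρ n).toMeasure hz
    have hwd := mp_w_diff (hsmall (n + 1)) (hsmall n)
    have E1 := (hρ (n + 1) z hz).1
    have E0 := (hρ n z hz).1
    set h₁ := mpH c (ρ (n + 1)).toMeasure z with hh₁
    set h₀ := mpH c (ρ n).toMeasure z
    have ED : mpH c (ρ (n + 1 + 1)).toMeasure z - h₁ =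
        ∫ x, ((c : ℂ) * ((s (n + 1) x : ℝ) * (((s (n + 1) x : ℝ) : ℂ) * (1 + h₁)⁻¹ - z)⁻¹) -
          (c : ℂ) * ((s n x : ℝ) * (((s n x : ℝ) : ℂ) * (1 + h₀)⁻¹ - z)⁻¹)) ∂H := by
      rw [integral_sub (hIc _ _ _ hz w₁) (hIc _ _ _ hz w₀), ← E1, ← E0]
    rw [ED]
    have hdi : Integrable (fun x => |s (n + 1) x - s n x|) H := by
      refine Integrable.of_bound (C := R)
        ((s (n + 1)).measurable.sub (s n).measurable).abs.aestronglyMeasurable ?_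
      refine Eventually.of_forall fun x => ?_
      rw [Real.norm_eq_abs, abs_abs, abs_le]
      have h1 := hs (n + 1) x
      have h2 := hs n x
      constructor <;> linarith [h1.1, h1.2, h2.1, h2.2]
    refine (norm_integral_le_of_norm_le (g := fun x =>
      c * (‖z‖ * (z.im⁻¹) ^ 2) * |s (n + 1) x - s n x| + ‖h₁ - h₀‖ / 2)
      ((hdi.const_mul _).add (integrable_const _)) ?_).trans ?_
    · refine Eventually.of_forall fun x => ?_
      have hy := hs (n + 1) x
      have hy' := hs n x
      have d1 := mp_diff_y (z := z) hz w₁ hy.1 hy'.1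
      have d2 := mp_diff_w (z := z) hz w₁ w₀ hy'.1 hy'.2
      set y := s (n + 1) x
      set y' := s n x
      set a := (1 + h₁)⁻¹
      set b := (1 + h₀)⁻¹
      have e : (c : ℂ) * (y * ((y : ℂ) * a - z)⁻¹) - c * (y' * ((y' : ℂ) * b - z)⁻¹) =
          c * ((y * ((y : ℂ) * a - z)⁻¹ - y' * ((y' : ℂ) * a - z)⁻¹) +
            y' * (((y' : ℂ) * a - z)⁻¹ - ((y' : ℂ) * b - z)⁻¹)) := by ring
      rw [e, norm_mul, Complex.norm_real, Real.norm_of_nonneg hc.le]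
      have d3 : ‖(y' : ℂ) * (((y' : ℂ) * a - z)⁻¹ - ((y' : ℂ) * b - z)⁻¹)‖ ≤
          R * (R * (z.im⁻¹) ^ 2 * (4 * ‖h₁ - h₀‖)) := by
        rw [norm_mul, Complex.norm_real, Real.norm_of_nonneg hy'.1]
        refine mul_le_mul hy'.2 (d2.trans ?_) (norm_nonneg _) hR.le
        gcongr
      have d4 := norm_add_le ((y : ℂ) * ((y : ℂ) * a - z)⁻¹ - y' * ((y' : ℂ) * a - z)⁻¹)
        ((y' : ℂ) * (((y' : ℂ) * a - z)⁻¹ - ((y' : ℂ) * b - z)⁻¹))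
      have d5 := mul_le_mul_of_nonneg_left (d4.trans (add_le_add d1 d3)) hc.le
      refine d5.trans ?_
      have d6 := mul_le_mul_of_nonneg_right hcon (norm_nonneg (h₁ - h₀))
      linarith
    · rw [integral_add (hdi.const_mul _) (integrable_const _), integral_const_mul]
      simp [add_comm]
  -- compactness
  obtain ⟨⟨σ, τ⟩, φ, hφ, hlim⟩ := CompactSpace.tendsto_subseq (fun n => (ρ n, ρ (n + 1)))
  have hσ : Tendsto (fun k => ρ (φ k)) atTop (𝓝 σ) := (continuous_fst.tendsto _).comp hlim
  have hτ : Tendsto (fun k => ρ (φ k + 1)) atTop (𝓝 τ) := (continuous_snd.tendsto _).comp hlim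
  have hhσ : ∀ z : ℂ, 0 < z.im →
      Tendsto (fun k => mpH c (ρ (φ k)).toMeasure z) atTop (𝓝 (mpH c σ.toMeasure z)) :=
    fun z hz => mp_tendsto_h (mp_cont_h c hz) hσ
  have hhτ : ∀ z : ℂ, 0 < z.im →
      Tendsto (fun k => mpH c (ρ (φ k + 1)).toMeasure z) atTop (𝓝 (mpH c τ.toMeasure z)) :=
    fun z hz => mp_tendsto_h (mp_cont_h c hz) hτ
  have hmτ : ∀ z : ℂ, 0 < z.im →
      Tendsto (fun k => mpM (ρ (φ k + 1)).toMeasure z) atTop (𝓝 (mpM τ.toMeasure z)) :=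
    fun z hz => mp_tendsto_h (mp_cont_inv hz) hτ
  have heqT : ∀ z : ℂ, T ≤ z.im → mpH c τ.toMeasure z = mpH c σ.toMeasure z := by
    intro z hTz
    have hz : 0 < z.im := hT0.trans_le hTz
    have h1 := ((hhτ z hz).sub (hhσ z hz)).norm
    have h2 := (hdiff z hTz).comp hφ.tendsto_atTop
    have := tendsto_nhds_unique h1 h2
    exact sub_eq_zero.1 (norm_eq_zero.1 this)
  have heq : ∀ z : ℂ, 0 < z.im → mpH c τ.toMeasure z = mpH c σ.toMeasure z := by
    intro z hz
    have hfi : ∀ μ : ProbabilityMeasure (Set.Icc (0:ℝ) R × Set.Icc (0:ℝ) K),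
        Integrable (fun ω : Set.Icc (0:ℝ) R × Set.Icc (0:ℝ) K => ((c * (ω.1 : ℝ) : ℝ) : ℂ))
          μ.toMeasure := fun μ => mp_int_cont _ (by fun_prop)
    exact mp_unique_fun τ.toMeasure σ.toMeasure _ _ (hfi τ) (hfi σ) K T
      (fun ω => ω.2) measurable_snd (fun ω => ω.2) measurable_snd
      (fun z _ hTz _ => heqT z hTz)
      ⟨fun x => (((x : ℝ) : ℂ) - z)⁻¹, Continuous.inv₀ (by fun_prop) (fun _ => mp_ne hz)⟩
  -- the limiting equations
  have hwlim : ∀ z : ℂ, 0 < z.im → Tendsto (fun k => (1 + mpH c (ρ (φ k)).toMeasure z)⁻¹) atTop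
      (𝓝 ((1 + mpH c σ.toMeasure z)⁻¹)) := fun z hz =>
    ((hhσ z hz).const_add 1).inv₀ (mpH_ne hc _ hz)
  have hslim' : ∀ x ∈ Set.Icc 0 R, Tendsto (fun k => ((s (φ k) x : ℝ) : ℂ)) atTop (𝓝 (x : ℂ)) :=
    fun x hx => (Complex.continuous_ofReal.tendsto x).comp
      ((hslim x hx).comp hφ.tendsto_atTop)
  have hptlim : ∀ z : ℂ, 0 < z.im → ∀ x ∈ Set.Icc 0 R,
      Tendsto (fun k => (((s (φ k) x : ℝ) : ℂ) * (1 + mpH c (ρ (φ k)).toMeasure z)⁻¹ - z)⁻¹)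
        atTop (𝓝 (((x : ℂ) * (1 + mpH c σ.toMeasure z)⁻¹ - z)⁻¹)) := by
    intro z hz x hx
    exact (((hslim' x hx).mul (hwlim z hz)).sub_const z).inv₀
      (mp_den_ne hz (mpH_w hc _ hz) hx.1)
  have Em : ∀ z : ℂ, 0 < z.im →
      mpM τ.toMeasure z = ∫ x, ((x : ℂ) * (1 + mpH c σ.toMeasure z)⁻¹ - z)⁻¹ ∂H := by
    intro z hz
    refine tendsto_nhds_unique (hmτ z hz) ?_
    simp only [fun k => (hρ (φ k) z hz).2]
    refine tendsto_integral_of_dominated_convergence (fun _ => z.im⁻¹)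
      (fun k => (hI _ _ _ hz (mpH_w hc _ hz)).aestronglyMeasurable) (integrable_const _)
      (fun k => Eventually.of_forall fun x => mp_inv_bound hz (mpH_w hc _ hz) (hs _ x).1) ?_
    filter_upwards [mp_ae hH] with x hx using hptlim z hz x hx
  have Eh : ∀ z : ℂ, 0 < z.im → mpH c σ.toMeasure z =
      ∫ x, (c : ℂ) * (x * ((x : ℂ) * (1 + mpH c σ.toMeasure z)⁻¹ - z)⁻¹) ∂H := by
    intro z hz
    conv_lhs => rw [← heq z hz]
    refine tendsto_nhds_unique (hhτ z hz) ?_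
    simp only [fun k => (hρ (φ k) z hz).1]
    refine tendsto_integral_of_dominated_convergence (fun _ => c * (R * z.im⁻¹))
      (fun k => (hIc _ _ _ hz (mpH_w hc _ hz)).aestronglyMeasurable) (integrable_const _)
      (fun k => Eventually.of_forall fun x => hbd _ _ _ hz (mpH_w hc _ hz) (hs _ x)) ?_
    filter_upwards [mp_ae hH] with x hx
    exact ((hslim' x hx).mul (hptlim z hz x hx)).const_mul _
  -- the measure
  have hmeas : Measurable (fun ω : Set.Icc (0:ℝ) R × Set.Icc (0:ℝ) K => (ω.2 : ℝ)) :=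
    measurable_subtype_coe.comp measurable_snd
  set ν : Measure ℝ := τ.toMeasure.map (fun ω => (ω.2 : ℝ)) with hν
  have hSt : ∀ z : ℂ, stieltjesTransform ν z = mpM τ.toMeasure z := by
    intro z
    rw [stieltjesTransform, hν, integral_map hmeas.aemeasurable]
    · rfl
    · exact (Complex.measurable_ofReal.sub_const z).inv.aestronglyMeasurable
  refine ⟨ν, Measure.isProbabilityMeasure_map hmeas.aemeasurable, ⟨K, ?_⟩, ?_⟩
  · rw [hν, Measure.map_apply hmeas measurableSet_Icc]
    have : (fun ω : Set.Icc (0:ℝ) R × Set.Icc (0:ℝ) K => (ω.2 : ℝ)) ⁻¹' Set.Icc 0 K = Set.univ := by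
      ext ω
      simp [ω.2.2.1, ω.2.2.2]
    rw [this, measure_univ]
  · intro z hz
    have hw : 1 - (c : ℂ) - (c : ℂ) * z * stieltjesTransform ν z =
        (1 + mpH c σ.toMeasure z)⁻¹ := by
      rw [hSt z]
      have e1 := Em z hz
      have e2 := Eh z hz
      have hne := mpH_ne hc σ.toMeasure hz
      have hwi := mpH_w hc σ.toMeasure hz
      set w := (1 + mpH c σ.toMeasure z)⁻¹ with hwdef
      set h := mpH c σ.toMeasure z
      have hIm : Integrable (fun x : ℝ => ((x : ℂ) * w - z)⁻¹) H := by
        refine Integrable.of_bound (C := z.im⁻¹) ?_ ?_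
        · exact ((Complex.measurable_ofReal.mul_const w).sub_const z).inv.aestronglyMeasurable
        · filter_upwards [mp_ae hH] with x hx using mp_inv_bound hz hwi hx.1
      have e3 : w * h = c * (1 + z * mpM τ.toMeasure z) := by
        rw [e1]
        conv_lhs => rw [e2]
        rw [← integral_const_mul, ← integral_const_mul]
        have : (1 : ℂ) + ∫ x : ℝ, z * ((x : ℂ) * w - z)⁻¹ ∂H =
            ∫ x : ℝ, (1 + z * ((x : ℂ) * w - z)⁻¹) ∂H := by
          rw [integral_add (integrable_const _) (hIm.const_mul z)]
          simp
        rw [this, ← integral_const_mul]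
        refine integral_congr_ae ?_
        filter_upwards [mp_ae hH] with x hx
        have hd := mp_den_ne hz hwi hx.1
        have hd' : (1 : ℂ) = ((x : ℂ) * w - z) * ((x : ℂ) * w - z)⁻¹ := (mul_inv_cancel₀ hd).symm
        linear_combination (-(c : ℂ)) * hd'
      have e4 : w * (1 + h) = 1 := inv_mul_cancel₀ hne
      linear_combination e3 - e4
    rw [hw, hSt z]
    exact Em z hz

/-- **The Marchenko–Pastur equation.** For every `c > 0` and every compactly supported
probability measure `H` on `[0,∞)`, there exists a unique compactly supported probability
measure `ν` on `[0,∞)` whose Stieltjes transform `m_ν` satisfies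
`m_ν(z) = ∫ 1 / (λ(1 - c - c z m_ν(z)) - z) dH(λ)` for all `z` in the upper half plane. -/
theorem marchenko_pastur_equation (c : ℝ) (hc : 0 < c)
    (H : Measure ℝ) (hHprob : IsProbabilityMeasure H)
    (hHsupp : ∃ R : ℝ, H (Set.Icc 0 R) = 1) :
    ∃! ν : Measure ℝ,
      IsProbabilityMeasure ν ∧ (∃ R : ℝ, ν (Set.Icc 0 R) = 1) ∧
        ∀ z : ℂ, 0 < z.im →
          stieltjesTransform ν z =
            ∫ x, ((x : ℂ) * (1 - (c : ℂ) - (c : ℂ) * z * stieltjesTransform ν z) - z)⁻¹ ∂H := by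
  obtain ⟨R, hH⟩ := hHsupp
  have hH' : H (Set.Icc 0 (max R 1)) = 1 :=
    le_antisymm prob_le_one
      (hH.symm.le.trans (measure_mono (Set.Icc_subset_Icc le_rfl (le_max_left R 1))))
  have hR : 0 < max R 1 := lt_max_of_lt_right one_pos
  obtain ⟨ν, h1, h2, h3⟩ := mp_existence c hc H hR hH'
  refine ⟨ν, ⟨h1, h2, h3⟩, ?_⟩
  rintro ν' ⟨h1', ⟨R', h2'⟩, h3'⟩
  obtain ⟨R₀, h2⟩ := h2
  exact mp_uniqueness c hc H hH ν' ν h2' h2 h3' h3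
end

section
/- Cycle bound for pairings of polygon edges: fix L ∈ ℕ and label the indices {1,...,2L} so that for q = 1,...,L index q has row-label q and column-label q, while index L+q has row-label (q mod L)+1 and column-label q. Let τ_r be the pairing of {1,...,2L} matching indices with equal row-label and τ_c the pairing matching indices with equal column-label. For a pairing π of {1,...,2L}, let C_r(π) be the set of equivalence classes of {1,...,2L} under the smallest equivalence relation containing a ∼ b for every {a,b} ∈ π ∪ τ_r, and define C_c(π) analogously with τ_c in place of τ_r. Then for every pairing π of {1,...,2L}: #C_r(π) + #C_c(π) ≤ L + 1. -/
open scoped Classical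

/-- The row-label of an index of the `2L`-polygon: index `q ∈ {0,...,L-1}` has row-label `q`,
and index `L+q` has row-label `(q+1) mod L` (this is the `0`-indexed version of the labels in
the statement). -/
def rowLabel (L : ℕ) (i : Fin (2 * L)) : ℕ :=
  if i.val < L then i.val else (i.val - L + 1) % L

/-- The column-label of an index of the `2L`-polygon: index `q ∈ {0,...,L-1}` has
column-label `q`, and index `L+q` has column-label `q`. -/
def colLabel (L : ℕ) (i : Fin (2 * L)) : ℕ :=
  if i.val < L then i.val else i.val - L

/-- The number of equivalence classes of the smallest equivalence relation containing a
relation `r` on `Fin n`. -/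
noncomputable def numCycles {n : ℕ} (r : Fin n → Fin n → Prop) : ℕ :=
  (Finset.univ.image (fun i : Fin n => {j : Fin n | Relation.EqvGen r i j})).card

/-- Functions invariant under a relation. -/
def invFun' {n : ℕ} (r : Fin n → Fin n → Prop) : Submodule ℚ (Fin n → ℚ) where
  carrier := {f | ∀ a b, r a b → f a = f b}
  add_mem' := by
    intro f g hf hg a b h
    simp [hf a b h, hg a b h]
  zero_mem' := by
    intro a b _
    rfl
  smul_mem' := by
    intro c f hf a b h
    simp [hf a b h]

lemma numCycles_le_finrank {n : ℕ} (r : Fin n → Fin n → Prop) :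
    numCycles r ≤ Module.finrank ℚ (invFun' r) := by
  let T := Finset.univ.image (fun i : Fin n => {j : Fin n | Relation.EqvGen r i j})
  let c : Fin n → T := fun i => ⟨{j : Fin n | Relation.EqvGen r i j},
    Finset.mem_image_of_mem _ (Finset.mem_univ i)⟩
  have hc : Function.Surjective c := by
    rintro ⟨t, ht⟩
    obtain ⟨i, _, hi⟩ := Finset.mem_image.1 ht
    exact ⟨i, Subtype.ext hi⟩
  have hinj := LinearMap.funLeft_injective_of_surjective ℚ ℚ c hc
  have h1 := LinearMap.finrank_range_of_inj hinj
  have h2 : LinearMap.range (LinearMap.funLeft ℚ ℚ c) ≤ invFun' r := by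
    rintro _ ⟨h, rfl⟩ a b hab
    have : c a = c b := by
      apply Subtype.ext
      ext j
      have hab' := Relation.EqvGen.rel _ _ hab
      exact ⟨fun h => (hab'.symm).trans _ _ _ h, fun h => hab'.trans _ _ _ h⟩
    simp [LinearMap.funLeft_apply, this]
  have h3 := Submodule.finrank_mono h2
  rw [h1, Module.finrank_fintype_fun_eq_card, Fintype.card_coe] at h3
  exact h3

lemma pairing_card {L : ℕ} {π : Finset (Finset (Fin (2 * L)))} (hπ : IsPairing π) :
    π.card = L := by
  have h := Finset.sum_card (B := π) (n := 1) (by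
    intro a
    obtain ⟨p, hp, hu⟩ := hπ.2 a
    rw [Finset.card_eq_one]
    refine ⟨p, ?_⟩
    ext q
    simp only [Finset.mem_filter, Finset.mem_singleton]
    exact ⟨fun h => hu q h, fun h => h ▸ hp⟩)
  rw [Finset.sum_congr rfl hπ.1] at h
  simp at h
  omega

lemma finrank_pairing_le {L : ℕ} {π : Finset (Finset (Fin (2 * L)))} (hπ : IsPairing π) :
    Module.finrank ℚ (invFun' (fun a b : Fin (2 * L) => ({a, b} : Finset (Fin (2 * L))) ∈ π))
      ≤ L := by
  have hne : ∀ p : π, ∃ i, i ∈ p.1 := fun p =>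
    Finset.card_pos.1 (by rw [hπ.1 p.1 p.2]; norm_num)
  choose e he using hne
  let φ := (LinearMap.funLeft ℚ ℚ e).comp
    (invFun' (fun a b : Fin (2 * L) => ({a, b} : Finset (Fin (2 * L))) ∈ π)).subtype
  have hφ : Function.Injective φ := by
    rw [← LinearMap.ker_eq_bot, LinearMap.ker_eq_bot']
    rintro ⟨f, hf⟩ h0
    apply Subtype.ext
    funext i
    obtain ⟨p, ⟨hp, hip⟩, _⟩ := hπ.2 i
    have h1 : f (e ⟨p, hp⟩) = 0 := congrFun h0 ⟨p, hp⟩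
    have hep := he ⟨p, hp⟩
    change f i = 0
    by_cases hie : i = e ⟨p, hp⟩
    · rw [hie, h1]
    · have hsub : ({i, e ⟨p, hp⟩} : Finset (Fin (2 * L))) = p := by
        apply Finset.eq_of_subset_of_card_le
        · intro x hx
          simp only [Finset.mem_insert, Finset.mem_singleton] at hx
          rcases hx with rfl | rfl
          · exact hip
          · exact hep
        · rw [hπ.1 p hp, Finset.card_pair hie]
      rw [← h1]
      apply hf
      rw [hsub]
      exact hp
  have := LinearMap.finrank_le_finrank_of_injective hφ
  rwa [Module.finrank_fintype_fun_eq_card, Fintype.card_coe, pairing_card hπ] at this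

lemma const_of_inv {L : ℕ} (hL : 0 < L) (f : Fin (2 * L) → ℚ)
    (hr : ∀ a b, rowLabel L a = rowLabel L b → f a = f b)
    (hc : ∀ a b, colLabel L a = colLabel L b → f a = f b) (i : Fin (2 * L)) :
    f i = f ⟨0, by omega⟩ := by
  have hcol : ∀ q (hq : q < L), f ⟨L + q, by omega⟩ = f ⟨q, by omega⟩ := by
    intro q hq
    apply hc
    simp [colLabel, hq]
  have hrow : ∀ q (hq : q + 1 < L), f ⟨q + 1, by omega⟩ = f ⟨L + q, by omega⟩ := by
    intro q hq
    apply hr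
    simp [rowLabel, hq, Nat.mod_eq_of_lt hq]
  have key : ∀ q (hq : q < L), f ⟨q, by omega⟩ = f ⟨0, by omega⟩ := by
    intro q
    induction q with
    | zero => intro _; rfl
    | succ q ih =>
      intro hq
      rw [hrow q hq, hcol q (by omega), ih (by omega)]
  obtain ⟨i, hi⟩ := i
  by_cases h : i < L
  · exact key i h
  · obtain ⟨q, rfl⟩ := Nat.exists_eq_add_of_le (not_lt.1 h)
    rw [hcol q (by omega), key q (by omega)]

/-- **Cycle bound for pairings of polygon edges.** For every pairing `π` of `{1,...,2L}`,
the number of row-cycles plus the number of column-cycles is at most `L + 1`. Here a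
row-cycle is an equivalence class of the smallest equivalence relation identifying the two
elements of each block of `π` and any two indices with equal row-label, and similarly for
column-cycles with column-labels. -/
theorem cycle_bound_pairings (L : ℕ) (hL : 0 < L)
    (π : Finset (Finset (Fin (2 * L)))) (hπ : IsPairing π) :
    numCycles (fun a b : Fin (2 * L) => ({a, b} : Finset (Fin (2 * L))) ∈ π ∨
        rowLabel L a = rowLabel L b) +
      numCycles (fun a b : Fin (2 * L) => ({a, b} : Finset (Fin (2 * L))) ∈ π ∨
        colLabel L a = colLabel L b) ≤ L + 1 := by
  set R := fun a b : Fin (2 * L) => ({a, b} : Finset (Fin (2 * L))) ∈ π ∨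
        rowLabel L a = rowLabel L b with hR
  set C := fun a b : Fin (2 * L) => ({a, b} : Finset (Fin (2 * L))) ∈ π ∨
        colLabel L a = colLabel L b with hC
  have h1 := numCycles_le_finrank R
  have h2 := numCycles_le_finrank C
  have h3 := Submodule.finrank_sup_add_finrank_inf_eq (invFun' R) (invFun' C)
  have h4 : invFun' R ⊔ invFun' C ≤
      invFun' (fun a b : Fin (2 * L) => ({a, b} : Finset (Fin (2 * L))) ∈ π) :=
    sup_le (fun f hf a b h => hf a b (Or.inl h)) (fun f hf a b h => hf a b (Or.inl h))
  have h5 := (Submodule.finrank_mono h4).trans (finrank_pairing_le hπ)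
  have h6 : invFun' R ⊓ invFun' C ≤ Submodule.span ℚ {(fun _ => 1 : Fin (2 * L) → ℚ)} := by
    rintro f ⟨hf, hg⟩
    rw [Submodule.mem_span_singleton]
    refine ⟨f ⟨0, by omega⟩, ?_⟩
    funext i
    rw [const_of_inv hL f (fun a b h => hf a b (Or.inr h)) (fun a b h => hg a b (Or.inr h)) i]
    simp
  have h7 := Submodule.finrank_mono h6
  have h8 := finrank_span_le_card (R := ℚ) ({(fun _ => 1 : Fin (2 * L) → ℚ)} : Set _)
  simp only [Set.toFinset_singleton, Finset.card_singleton] at h8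
  omega
end
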